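/- Suppose k is infinite with char(k) = 0, d ≥ 2, and n is sufficiently large. Then a general principal symmetric ideal I generated in degree d yields A = R/I with Hilbert function HF_A(i) = dim_k R_i for i ≤ d−1, HF_A(d) = P(d) − 1, and HF_A(i) = 0 for i > d; moreover A is a d-extremely narrow algebra with socle polynomial (C(n+d−2, d−1) − (n−1)P(d) − P(d−1) + n − 1)·z^{d−1} + (P(d)−1)·z^d. -/

import Mathlib

open MvPolynomial

noncomputable section
namespace PSI

open scoped Classical

variable (k : Type) [Field k] (n : ℕ)

/-- The contraction action of `R = k[x_1,…,x_n]` on its graded dual `S`, where `S` is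
modeled by polynomials in the dual variables `y_i` (dual basis to the monomial basis);
on basis elements, `x^d ∘ y^(e) = y^(e-d)` if `d ≤ e` componentwise and `0` otherwise. -/
def contract (f g : MvPolynomial (Fin n) k) : MvPolynomial (Fin n) k :=
  ∑ d ∈ f.support, f.coeff d • g.divMonomial d

theorem divMonomial_add (a b : MvPolynomial (Fin n) k) (s : Fin n →₀ ℕ) :
    (a + b).divMonomial s = a.divMonomial s + b.divMonomial s := by
  ext c; simp [MvPolynomial.coeff_divMonomial]

theorem divMonomial_smul (r : k) (a : MvPolynomial (Fin n) k) (s : Fin n →₀ ℕ) :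
    (r • a).divMonomial s = r • a.divMonomial s := by
  ext c; simp [MvPolynomial.coeff_divMonomial]

theorem divMonomial_zero (s : Fin n →₀ ℕ) :
    (0 : MvPolynomial (Fin n) k).divMonomial s = 0 := by
  ext c; simp [MvPolynomial.coeff_divMonomial]

theorem contract_add_right (f a b : MvPolynomial (Fin n) k) :
    contract k n f (a + b) = contract k n f a + contract k n f b := by
  simp [contract, divMonomial_add, smul_add, Finset.sum_add_distrib]

theorem contract_smul_right (f : MvPolynomial (Fin n) k) (r : k) (a : MvPolynomial (Fin n) k) :
    contract k n f (r • a) = r • contract k n f a := by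
  simp only [contract, divMonomial_smul]
  rw [Finset.smul_sum]
  exact Finset.sum_congr rfl fun d _ => smul_comm _ _ _

theorem contract_zero_right (f : MvPolynomial (Fin n) k) : contract k n f 0 = 0 := by
  simp [contract, divMonomial_zero]

/-- The degree `-d` graded piece of the Macaulay inverse system `I^⊥ ⊆ S`:
homogeneous dual polynomials of degree `d` annihilated by `I` under contraction. -/
def perpSub (I : Ideal (MvPolynomial (Fin n) k)) (d : ℕ) :
    Submodule k (MvPolynomial (Fin n) k) where
  carrier := {g | g ∈ homogeneousSubmodule (Fin n) k d ∧ ∀ f ∈ I, contract k n f g = 0}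
  add_mem' := by
    rintro a b ⟨ha1, ha2⟩ ⟨hb1, hb2⟩
    exact ⟨Submodule.add_mem _ ha1 hb1, fun f hf => by
      rw [contract_add_right, ha2 f hf, hb2 f hf, add_zero]⟩
  zero_mem' := ⟨Submodule.zero_mem _, fun f _ => contract_zero_right k n f⟩
  smul_mem' := by
    rintro c a ⟨ha1, ha2⟩
    exact ⟨Submodule.smul_mem _ c ha1, fun f hf => by
      rw [contract_smul_right, ha2 f hf, smul_zero]⟩

/-- The full Macaulay inverse system `I^⊥` as a subset of `S`. -/
def perpSet (I : Ideal (MvPolynomial (Fin n) k)) : Set (MvPolynomial (Fin n) k) :=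
  {g | ∀ f ∈ I, contract k n f g = 0}



/-- The degree `m` graded piece of `A = R/I`, as a `k`-subspace of the quotient. -/
def Agr (I : Ideal (MvPolynomial (Fin n) k)) (m : ℕ) :
    Submodule k (MvPolynomial (Fin n) k ⧸ I) :=
  (homogeneousSubmodule (Fin n) k m).map (Ideal.Quotient.mkₐ k I).toLinearMap

/-- The socle of `A = R/I`: elements annihilated by all the variables. -/
def socSub (I : Ideal (MvPolynomial (Fin n) k)) :
    Submodule k (MvPolynomial (Fin n) k ⧸ I) :=
  ⨅ j : Fin n, LinearMap.ker (LinearMap.mulLeft k (Ideal.Quotient.mk I (X j)))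

/-- `dim_k Soc(A)_j`. -/
def socdim (I : Ideal (MvPolynomial (Fin n) k)) (j : ℕ) : ℕ :=
  Module.finrank k ↥(Agr k n I j ⊓ socSub k n I)

/-- Hilbert function of `A = R/I`. -/
def hfA (I : Ideal (MvPolynomial (Fin n) k)) (i : ℕ) : ℕ :=
  Module.finrank k ↥(Agr k n I i)

/-- `dim_k R_i`. -/
def rdim (i : ℕ) : ℕ := Module.finrank k ↥(homogeneousSubmodule (Fin n) k i)

/-- The degree `i` graded piece of a homogeneous ideal `I`. -/
def Igrade (I : Ideal (MvPolynomial (Fin n) k)) (i : ℕ) :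
    Submodule k (MvPolynomial (Fin n) k) :=
  homogeneousSubmodule (Fin n) k i ⊓ Submodule.restrictScalars k I

/-- The initial degree `t(I)` of a homogeneous ideal. -/
def tdeg (I : Ideal (MvPolynomial (Fin n) k)) : ℕ := sInf {i | Igrade k n I i ≠ ⊥}

/-- The top socle degree `s(A)` of `A = R/I`. -/
def sdeg (I : Ideal (MvPolynomial (Fin n) k)) : ℕ :=
  sSup {i | Agr k n I i ⊓ socSub k n I ≠ ⊥}

/-- `I` is a homogeneous ideal. -/
def IsHomog (I : Ideal (MvPolynomial (Fin n) k)) : Prop :=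
  ∀ f ∈ I, ∀ m : ℕ, homogeneousComponent m f ∈ I

/-- `A = R/I` is a narrow algebra: an artinian graded quotient with `t(I) ≥ s(A)`. -/
def IsNarrow (I : Ideal (MvPolynomial (Fin n) k)) : Prop :=
  IsHomog k n I ∧ IsArtinianRing (MvPolynomial (Fin n) k ⧸ I) ∧ sdeg k n I ≤ tdeg k n I

/-- The homogeneous maximal ideal `m = (x_1,…,x_n)`. -/
def mIdeal : Ideal (MvPolynomial (Fin n) k) := Ideal.span (Set.range X)

/-- The space of linear relations `L_{F_1,…,F_a} ⊆ R_1^a`. -/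
def Lset {a : ℕ} (F : Fin a → MvPolynomial (Fin n) k) :
    Set (Fin a → MvPolynomial (Fin n) k) :=
  {ℓ | (∀ i, ℓ i ∈ homogeneousSubmodule (Fin n) k 1) ∧
    ∑ i, contract k n (ℓ i) (F i) = 0}

/-- `dim_k L_{F_1,…,F_a}` (the set of linear relations is a subspace, so its span is itself). -/
def lDim {a : ℕ} (F : Fin a → MvPolynomial (Fin n) k) : ℕ :=
  Module.finrank k ↥(Submodule.span k (Lset k n F))

/-- `F_1,…,F_a` is a basis of the degree `-d` part `(I^⊥)_{-d}` of the inverse system. -/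
def IsBasisOfPerp (I : Ideal (MvPolynomial (Fin n) k)) (d : ℕ) {a : ℕ}
    (F : Fin a → MvPolynomial (Fin n) k) : Prop :=
  LinearIndependent k F ∧ (∀ i, F i ∈ perpSub k n I d) ∧
    ∀ g ∈ perpSub k n I d, g ∈ Submodule.span k (Set.range F)

/-- `A = R/I` is a `d`-extremely narrow algebra. -/
def IsExtremelyNarrow (d : ℕ) (I : Ideal (MvPolynomial (Fin n) k)) : Prop :=
  IsHomog k n I ∧ IsArtinianRing (MvPolynomial (Fin n) k ⧸ I) ∧
  sdeg k n I = d ∧ tdeg k n I = d ∧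
  ∃ (a : ℕ) (F : Fin a → MvPolynomial (Fin n) k), IsBasisOfPerp k n I d F ∧
    ∃ x ∈ homogeneousSubmodule (Fin n) k 1,
      ∀ ℓ ∈ Lset k n F, ∃ c : Fin a → k, ℓ = fun i => c i • x
/-- The principal symmetric ideal `(f)_{S_n}` generated by the orbit of `f` under the
symmetric group permuting the variables. -/
def psi (f : MvPolynomial (Fin n) k) : Ideal (MvPolynomial (Fin n) k) :=
  Ideal.span {g | ∃ σ : Equiv.Perm (Fin n), g = rename σ f}

/-- Index type for the coordinates on the parameter space of degree-`d` forms: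
exponent vectors of total degree `d`. -/
def DegMon (d : ℕ) : Type := {m : Fin n →₀ ℕ // (m.sum fun _ e => e) = d}

/-- "A general principal symmetric ideal generated in degree `d` satisfies `P`":
there is a nonzero polynomial `h` in the coefficients (i.e. a nonempty Zariski-open
subset of the parameter space `P^{N-1}`) such that `(f)_{S_n}` satisfies `P` whenever
the coefficient vector of the degree-`d` form `f` does not lie on the hypersurface `h = 0`. -/
def GeneralPSI (d : ℕ) (P : Ideal (MvPolynomial (Fin n) k) → Prop) : Prop :=
  ∃ h : MvPolynomial (DegMon n d) k, h ≠ 0 ∧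
    ∀ f ∈ homogeneousSubmodule (Fin n) k d,
      eval (fun m => coeff m.1 f) h ≠ 0 → P (psi k n f)

/-- `P(d)`, the number of partitions of `d`. -/
def Pnum (d : ℕ) : ℕ := Fintype.card (Nat.Partition d)

/-- total degree (weight) of an exponent vector. -/
def wt (m : Fin n →₀ ℕ) : ℕ := m.sum fun _ e => e

/-- The type of a monomial: the multiset of its nonzero exponents (a partition of its degree). -/
def typeOf (m : Fin n →₀ ℕ) : Multiset ℕ := m.support.val.map m

/-- The finite set of exponent vectors of total degree `d`. -/
def expFinset (d : ℕ) : Finset (Fin n →₀ ℕ) :=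
  ((Finset.univ : Finset (Fin n → Fin (d + 1))).image
    (fun v => Finsupp.equivFunOnFinite.symm fun i => (v i : ℕ))).filter
      (fun e => wt n e = d)

/-- The monomial symmetric polynomial `m_λ` (of degree `d = λ.sum`): the sum of all
monomials of type `λ`. -/
def msym (d : ℕ) (lam : Multiset ℕ) : MvPolynomial (Fin n) k :=
  ∑ e ∈ (expFinset n d).filter (fun e => typeOf n e = lam), monomial e 1

end PSI

open PSI

namespace PSI

section Exponents

variable {n : ℕ}

theorem count_typeOf (e : Fin n →₀ ℕ) {c : ℕ} (hc : c ≠ 0) :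
    (typeOf n e).count c = Fintype.card {i // e i = c} := by
  rw [typeOf, Multiset.count_map, Fintype.card_subtype, ← Finset.filter_val, Finset.card_val]
  congr 1
  ext i
  simp only [Finset.mem_filter, Finsupp.mem_support_iff, Finset.mem_univ, true_and]
  constructor
  · rintro ⟨-, h⟩; exact h.symm
  · intro h; exact ⟨h ▸ hc, h.symm⟩

theorem card_typeOf (e : Fin n →₀ ℕ) :
    (typeOf n e).card + Fintype.card {i // e i = 0} = n := by
  have h := Fintype.card_subtype_compl (fun i => e i = 0)
  have h' : (typeOf n e).card = Fintype.card {i // ¬ e i = 0} := by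
    rw [typeOf, Multiset.card_map, Finset.card_val, Fintype.card_subtype]
    congr 1
    ext i; simp
  have := Fintype.card_subtype_le (fun i => e i = 0)
  rw [Fintype.card_fin] at *
  omega

/-- Exponent vectors of the same type are conjugate under the symmetric group. -/
theorem exists_perm_of_typeOf_eq {e e' : Fin n →₀ ℕ} (h : typeOf n e = typeOf n e') :
    ∃ σ : Equiv.Perm (Fin n), e' = e.mapDomain σ := by
  have key : ∀ c, Fintype.card {i // e i = c} = Fintype.card {i // e' i = c} := by
    intro c
    rcases eq_or_ne c 0 with rfl | hc
    · have h1 := card_typeOf e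
      have h2 := card_typeOf e'
      rw [h] at h1
      omega
    · rw [← count_typeOf e hc, ← count_typeOf e' hc, h]
  let σ : Equiv.Perm (Fin n) := Equiv.ofFiberEquiv fun c => Fintype.equivOfCardEq (key c)
  refine ⟨σ, ?_⟩
  ext i
  obtain ⟨j, rfl⟩ := σ.surjective i
  rw [Finsupp.mapDomain_apply σ.injective]
  exact Equiv.ofFiberEquiv_map (fun c => Fintype.equivOfCardEq (key c)) j

theorem typeOf_mapDomain (e : Fin n →₀ ℕ) (σ : Equiv.Perm (Fin n)) :
    typeOf n (e.mapDomain σ) = typeOf n e := by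
  ext c
  rcases eq_or_ne c 0 with rfl | hc
  · rw [Multiset.count_eq_zero_of_notMem, Multiset.count_eq_zero_of_notMem] <;>
      simp [typeOf]
  · rw [count_typeOf _ hc, count_typeOf _ hc]
    refine (Fintype.card_congr (σ.subtypeEquiv fun i => ?_)).symm
    rw [Finsupp.mapDomain_apply σ.injective]

theorem typeOf_add_single {e : Fin n →₀ ℕ} {b : Fin n} (hb : e b = 0) {a : ℕ} (ha : a ≠ 0) :
    typeOf n (e + Finsupp.single b a) = a ::ₘ typeOf n e := by
  have hs : (e + Finsupp.single b a).support = insert b e.support := by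
    ext i
    rcases eq_or_ne i b with rfl | hi
    · simp [ha]
    · simp [hi]
  have hb' : b ∉ e.support := by simpa using hb
  rw [typeOf, hs, Finset.insert_val_of_notMem hb', Multiset.map_cons]
  congr 1
  · simp [hb]
  · refine Multiset.map_congr rfl fun i hi => ?_
    have : b ≠ i := by rintro rfl; exact hb' hi
    simp [this]

theorem sum_typeOf (e : Fin n →₀ ℕ) : (typeOf n e).sum = e.degree := rfl

/-- Every multiset of positive integers is the type of an exponent vector supported on a given
large enough set of variables. -/
theorem exists_typeOf_eq (s : Multiset ℕ) (hs : ∀ a ∈ s, a ≠ 0) (A : Finset (Fin n))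
    (hA : s.card ≤ A.card) : ∃ e : Fin n →₀ ℕ, e.support ⊆ A ∧ typeOf n e = s := by
  induction s using Multiset.induction_on generalizing A with
  | empty => exact ⟨0, by simp, by simp [typeOf]⟩
  | cons a s ih =>
    rw [Multiset.card_cons] at hA
    obtain ⟨b, hb⟩ : A.Nonempty := Finset.card_pos.1 (by omega)
    obtain ⟨e, he, hes⟩ := ih (fun x hx => hs x (Multiset.mem_cons_of_mem hx)) (A.erase b)
      (by rw [Finset.card_erase_of_mem hb]; omega)
    have hb0 : e b = 0 := by
      by_contra h
      simpa using he (Finsupp.mem_support_iff.2 h)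
    refine ⟨e + Finsupp.single b a, ?_, ?_⟩
    · refine Finsupp.support_add.trans (Finset.union_subset
        (he.trans (Finset.erase_subset _ _)) (Finsupp.support_single_subset.trans ?_))
      simpa using hb
    · rw [typeOf_add_single hb0 (hs a (Multiset.mem_cons_self _ _)), hes]

/-- The type of an exponent vector of degree `d`, as a partition of `d`. -/
def ptype (d : ℕ) (e : Fin n →₀ ℕ) : Nat.Partition d :=
  if h : e.degree = d then
    ⟨typeOf n e, fun {i} hi => by
      obtain ⟨j, hj, rfl⟩ := Multiset.mem_map.1 hi
      exact Nat.pos_of_ne_zero (Finsupp.mem_support_iff.1 hj), h⟩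
  else default

theorem ptype_parts {d : ℕ} {e : Fin n →₀ ℕ} (h : e.degree = d) :
    (ptype d e).parts = typeOf n e := by
  rw [ptype, dif_pos h]

theorem degree_mapDomain_perm (e : Fin n →₀ ℕ) (σ : Equiv.Perm (Fin n)) :
    (e.mapDomain σ).degree = e.degree := by
  rw [← sum_typeOf, typeOf_mapDomain, sum_typeOf]

theorem ptype_mapDomain (d : ℕ) (e : Fin n →₀ ℕ) (σ : Equiv.Perm (Fin n)) :
    ptype d (e.mapDomain σ) = ptype d e := by
  unfold ptype
  simp only [degree_mapDomain_perm, typeOf_mapDomain]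

theorem exists_perm_of_ptype_eq {d : ℕ} {e e' : Fin n →₀ ℕ} (he : e.degree = d)
    (he' : e'.degree = d) (h : ptype d e = ptype d e') :
    ∃ σ : Equiv.Perm (Fin n), e' = e.mapDomain σ := by
  apply exists_perm_of_typeOf_eq
  rw [← ptype_parts he, ← ptype_parts he', h]

theorem card_parts_le {d : ℕ} (p : Nat.Partition d) : p.parts.card ≤ d := by
  have h : ∀ s : Multiset ℕ, (∀ a ∈ s, 0 < a) → s.card ≤ s.sum := by
    intro s
    induction s using Multiset.induction_on with
    | empty => simp
    | cons a s ih =>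
      intro hs
      have h1 := ih fun x hx => hs x (Multiset.mem_cons_of_mem hx)
      have h2 := hs a (Multiset.mem_cons_self _ _)
      rw [Multiset.card_cons, Multiset.sum_cons]
      omega
  have := h p.parts fun a ha => p.parts_pos ha
  rwa [p.parts_sum] at this

theorem exists_ptype_eq {d : ℕ} (p : Nat.Partition d) (A : Finset (Fin n)) (hA : d ≤ A.card) :
    ∃ e : Fin n →₀ ℕ, e.support ⊆ A ∧ e.degree = d ∧ ptype d e = p := by
  obtain ⟨e, he, hes⟩ := exists_typeOf_eq p.parts (fun a ha => (p.parts_pos ha).ne') A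
    ((card_parts_le p).trans hA)
  have hd : e.degree = d := by rw [← sum_typeOf, hes, p.parts_sum]
  exact ⟨e, he, hd, Nat.Partition.ext (by rw [ptype_parts hd, hes])⟩

/-- A function on exponent vectors of degree `d + 1` that does not change when one unit is moved
from one variable to another is constant. -/
theorem eq_of_forall_add_single_eq {α : Type*} {d : ℕ} {g : (Fin n →₀ ℕ) → α}
    (h : ∀ e : Fin n →₀ ℕ, e.degree = d → ∀ a b,
      g (e + Finsupp.single a 1) = g (e + Finsupp.single b 1))
    {e e' : Fin n →₀ ℕ} (he : e.degree = d + 1) (he' : e'.degree = d + 1) : g e = g e' := by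
  have key : ∀ N (c e e' : Fin n →₀ ℕ), e.degree = N → e'.degree = N → c.degree + N = d + 1 →
      g (c + e) = g (c + e') := by
    intro N
    induction N with
    | zero =>
      intro c e e' h1 h2 _
      rw [Finsupp.degree_eq_zero_iff] at h1 h2
      rw [h1, h2]
    | succ N ih =>
      intro c e e' h1 h2 h3
      have split : ∀ e : Fin n →₀ ℕ, e.degree = N + 1 →
          ∃ (a : Fin n) (u : Fin n →₀ ℕ), u.degree = N ∧ e = u + Finsupp.single a 1 := by
        intro e he
        have : e ≠ 0 := by rintro rfl; simp at he
        obtain ⟨a, ha⟩ := Finsupp.ne_iff.1 this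
        have hle : Finsupp.single a 1 ≤ e := by
          rw [Finsupp.single_le_iff]; exact Nat.one_le_iff_ne_zero.2 ha
        refine ⟨a, e - Finsupp.single a 1, ?_, (tsub_add_cancel_of_le hle).symm⟩
        have := congrArg Finsupp.degree (tsub_add_cancel_of_le hle)
        rw [map_add, Finsupp.degree_single, he] at this
        omega
      obtain ⟨a, u, hu, rfl⟩ := split e h1
      obtain ⟨b, u', hu', rfl⟩ := split e' h2
      rw [← add_assoc, h (c + u) (by rw [map_add]; omega) a b, ← add_assoc, add_right_comm,
        add_right_comm c u']
      refine ih _ _ _ hu hu' ?_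
      rw [map_add, Finsupp.degree_single]
      omega
  simpa using key (d + 1) 0 e e' he he' (by simp)

end Exponents

end PSI

namespace PSI

section General

variable {k : Type} [Field k] {n : ℕ}

theorem homogeneousSubmodule_eq_span (d : ℕ) :
    homogeneousSubmodule (Fin n) k d =
      Submodule.span k ((fun e => monomial e (1 : k)) '' {e | e.degree = d}) := by
  apply le_antisymm
  · intro p hp
    rw [p.as_sum]
    refine Submodule.sum_mem _ fun e he => ?_
    have hd : e.degree = d := by
      by_contra h
      exact mem_support_iff.1 he (IsHomogeneous.coeff_eq_zero hp h)
    have : monomial e (coeff e p) = coeff e p • monomial e (1 : k) := by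
      rw [smul_monomial, smul_eq_mul, mul_one]
    rw [this]
    exact Submodule.smul_mem _ _ (Submodule.subset_span ⟨e, hd, rfl⟩)
  · rw [Submodule.span_le]
    rintro _ ⟨e, he, rfl⟩
    exact isHomogeneous_monomial _ he

theorem mem_of_homogeneous {d : ℕ} {S : Submodule k (MvPolynomial (Fin n) k)}
    (h : ∀ e : Fin n →₀ ℕ, e.degree = d → monomial e (1 : k) ∈ S)
    {p : MvPolynomial (Fin n) k} (hp : p ∈ homogeneousSubmodule (Fin n) k d) : p ∈ S := by
  rw [homogeneousSubmodule_eq_span] at hp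
  refine Submodule.span_le.2 ?_ hp
  rintro _ ⟨e, he, rfl⟩
  exact h e he

theorem eq_on_homogeneous {d : ℕ} {V : Type*} [AddCommGroup V] [Module k V]
    {A B : MvPolynomial (Fin n) k →ₗ[k] V}
    (h : ∀ e : Fin n →₀ ℕ, e.degree = d → A (monomial e 1) = B (monomial e 1))
    {p : MvPolynomial (Fin n) k} (hp : p ∈ homogeneousSubmodule (Fin n) k d) : A p = B p :=
  mem_of_homogeneous (S := LinearMap.eqLocus A B) h hp

instance finite_homogeneousSubmodule (d : ℕ) :
    Module.Finite k (homogeneousSubmodule (Fin n) k d) :=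
  Module.Finite.iff_fg.2 (homogeneousSubmodule_fg (Fin n) k d)

theorem mapDomain_mapDomain (e : Fin n →₀ ℕ) (σ τ : Equiv.Perm (Fin n)) :
    (e.mapDomain σ).mapDomain τ = e.mapDomain (τ * σ : Equiv.Perm (Fin n)) := by
  rw [← Finsupp.mapDomain_comp]; rfl

theorem mapDomain_swap_of_eq {e : Fin n →₀ ℕ} {a b : Fin n} (h : e a = e b) :
    e.mapDomain (Equiv.swap a b) = e := by
  ext i
  obtain ⟨j, rfl⟩ := (Equiv.swap a b).surjective i
  rw [Finsupp.mapDomain_apply (Equiv.swap a b).injective]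
  rcases eq_or_ne j a with rfl | ha
  · rw [Equiv.swap_apply_left, h]
  rcases eq_or_ne j b with rfl | hb
  · rw [Equiv.swap_apply_right, h]
  rw [Equiv.swap_apply_of_ne_of_ne ha hb]

theorem mapDomain_swap_left (e : Fin n →₀ ℕ) (a b : Fin n) :
    e.mapDomain (Equiv.swap a b) a = e b := by
  have := Finsupp.mapDomain_apply (Equiv.swap a b).injective e b
  rwa [Equiv.swap_apply_right] at this

theorem mapDomain_swap_right (e : Fin n →₀ ℕ) (a b : Fin n) :
    e.mapDomain (Equiv.swap a b) b = e a := by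
  rw [Equiv.swap_comm, mapDomain_swap_left]

theorem mapDomain_swap_of_ne (e : Fin n →₀ ℕ) {a b c : Fin n} (ha : c ≠ a) (hb : c ≠ b) :
    e.mapDomain (Equiv.swap a b) c = e c := by
  have := Finsupp.mapDomain_apply (Equiv.swap a b).injective e c
  rwa [Equiv.swap_apply_of_ne_of_ne ha hb] at this

/-- The linear span of the orbit of `f` under the symmetric group. -/
def orbitSpan (f : MvPolynomial (Fin n) k) : Submodule k (MvPolynomial (Fin n) k) :=
  Submodule.span k (Set.range fun σ : Equiv.Perm (Fin n) => rename σ f)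

theorem rename_mem_orbitSpan (f : MvPolynomial (Fin n) k) (σ : Equiv.Perm (Fin n)) :
    rename σ f ∈ orbitSpan f :=
  Submodule.subset_span ⟨σ, rfl⟩

theorem self_mem_orbitSpan (f : MvPolynomial (Fin n) k) : f ∈ orbitSpan f := by
  simpa using rename_mem_orbitSpan f 1

theorem rename_mem_orbitSpan_of_mem {f p : MvPolynomial (Fin n) k} (hp : p ∈ orbitSpan f)
    (τ : Equiv.Perm (Fin n)) : rename τ p ∈ orbitSpan f := by
  have : orbitSpan f ≤ (orbitSpan f).comap (rename τ : _ →ₐ[k] _).toLinearMap := by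
    refine Submodule.span_le.2 ?_
    rintro _ ⟨σ, rfl⟩
    change rename τ (rename σ f) ∈ orbitSpan f
    rw [rename_rename]
    exact rename_mem_orbitSpan f (τ * σ)
  exact this hp

variable (k n) in
/-- The span of the differences of conjugate monomials of degree `d`. -/
def diffSpan (d : ℕ) : Submodule k (MvPolynomial (Fin n) k) :=
  Submodule.span k {p | ∃ (e : Fin n →₀ ℕ) (σ : Equiv.Perm (Fin n)), e.degree = d ∧
    p = monomial e 1 - monomial (e.mapDomain σ) 1}

theorem diffSpan_le_homogeneousSubmodule (d : ℕ) :
    diffSpan k n d ≤ homogeneousSubmodule (Fin n) k d := by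
  refine Submodule.span_le.2 ?_
  rintro _ ⟨e, σ, he, rfl⟩
  exact Submodule.sub_mem _ (isHomogeneous_monomial _ he)
    (isHomogeneous_monomial _ (by rw [degree_mapDomain_perm, he]))

theorem sub_rename_mem_diffSpan {d : ℕ} {p : MvPolynomial (Fin n) k}
    (hp : p ∈ homogeneousSubmodule (Fin n) k d) (σ : Equiv.Perm (Fin n)) :
    p - rename σ p ∈ diffSpan k n d := by
  refine mem_of_homogeneous (S := (diffSpan k n d).comap
    (LinearMap.id - (rename σ : _ →ₐ[k] _).toLinearMap)) (fun e he => ?_) hp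
  change monomial e 1 - rename σ (monomial e 1) ∈ diffSpan k n d
  rw [rename_monomial]
  exact Submodule.subset_span ⟨e, σ, he, rfl⟩

/-- A sum of monomials of all types, with pairwise disjoint supports and avoiding one variable,
generates all differences of conjugate monomials. -/
theorem diffSpan_le_orbitSpan_sum {d : ℕ} (E : Nat.Partition d → Fin n →₀ ℕ) (z : Fin n)
    (hdeg : ∀ p, (E p).degree = d) (htype : ∀ p, ptype d (E p) = p)
    (hz : ∀ p, E p z = 0) (hdisj : ∀ p q a, E p a ≠ 0 → E q a ≠ 0 → p = q) (hn : d < n) :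
    diffSpan k n d ≤ orbitSpan (∑ p, monomial (E p) (1 : k)) := by
  set f₀ : MvPolynomial (Fin n) k := ∑ p, monomial (E p) 1
  set W := orbitSpan f₀
  have step1 : ∀ p a, E p a ≠ 0 →
      monomial (E p) (1 : k) - monomial ((E p).mapDomain (Equiv.swap a z)) 1 ∈ W := by
    intro p a ha
    have : monomial (E p) (1 : k) - monomial ((E p).mapDomain (Equiv.swap a z)) 1 =
        f₀ - rename (Equiv.swap a z) f₀ := by
      simp only [f₀, map_sum, rename_monomial, ← Finset.sum_sub_distrib]
      symm
      refine Finset.sum_eq_single p (fun q _ hq => ?_) fun h => absurd (Finset.mem_univ p) h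
      have : E q a = 0 := by
        by_contra h
        exact hq (hdisj q p a h ha)
      rw [mapDomain_swap_of_eq (by rw [this, hz]), sub_self]
    rw [this]
    exact Submodule.sub_mem _ (self_mem_orbitSpan f₀) (rename_mem_orbitSpan f₀ _)
  have step2 : ∀ e : Fin n →₀ ℕ, e.degree = d → ∀ a b, e a ≠ 0 → e b = 0 →
      monomial e (1 : k) - monomial (e.mapDomain (Equiv.swap a b)) 1 ∈ W := by
    intro e he a b ha hb
    obtain ⟨τ, hτ⟩ := exists_perm_of_ptype_eq (hdeg (ptype d e)) he (htype _)
    set p := ptype d e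
    obtain ⟨b', rfl⟩ := τ.surjective b
    obtain ⟨a', rfl⟩ := τ.surjective a
    rw [hτ, Finsupp.mapDomain_apply τ.injective] at ha hb
    have hab : a' ≠ b' := by rintro rfl; exact ha hb
    have haz : a' ≠ z := by rintro rfl; exact ha (hz p)
    set τ' : Equiv.Perm (Fin n) := τ * Equiv.swap b' z with hτ'
    have hτe : e = (E p).mapDomain τ' := by
      rw [hτ', ← mapDomain_mapDomain, mapDomain_swap_of_eq (by rw [hb, hz]), hτ]
    have h1 : τ' a' = τ a' := by
      rw [hτ', Equiv.Perm.mul_apply, Equiv.swap_apply_of_ne_of_ne hab haz]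
    have h2 : τ' z = τ b' := by
      rw [hτ', Equiv.Perm.mul_apply, Equiv.swap_apply_right]
    have h3 : Equiv.swap (τ a') (τ b') * τ' = τ' * Equiv.swap a' z := by
      rw [← h1, ← h2, Equiv.mul_swap_eq_swap_mul]
    have := rename_mem_orbitSpan_of_mem (step1 p a' ha) τ'
    rwa [map_sub, rename_monomial, rename_monomial, ← hτe, mapDomain_mapDomain, ← h3,
      ← mapDomain_mapDomain, ← hτe] at this
  have step3 : ∀ e : Fin n →₀ ℕ, e.degree = d → ∀ a b,
      monomial e (1 : k) - monomial (e.mapDomain (Equiv.swap a b)) 1 ∈ W := by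
    intro e he a b
    by_cases ha : e a = 0
    · by_cases hb : e b = 0
      · rw [mapDomain_swap_of_eq (by rw [ha, hb]), sub_self]
        exact Submodule.zero_mem _
      · rw [Equiv.swap_comm]
        exact step2 e he b a hb ha
    · by_cases hb : e b = 0
      · exact step2 e he a b ha hb
      · rcases eq_or_ne a b with rfl | hab
        · rw [mapDomain_swap_of_eq rfl, sub_self]
          exact Submodule.zero_mem _
        obtain ⟨c, hc⟩ : ∃ c, e c = 0 := by
          by_contra! hcon
          have h1 : e.support = Finset.univ := by
            ext i; simp [hcon i]
          have h2 : (typeOf n e).card ≤ d := by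
            rw [← ptype_parts he]; exact card_parts_le _
          rw [typeOf, Multiset.card_map, h1, Finset.card_val, Finset.card_univ,
            Fintype.card_fin] at h2
          omega
        have hac : a ≠ c := by rintro rfl; exact ha hc
        have hbc : b ≠ c := by rintro rfl; exact hb hc
        set e₁ := e.mapDomain (Equiv.swap a c) with he₁
        set e₂ := e₁.mapDomain (Equiv.swap b a) with he₂
        have r1 := step2 e he a c ha hc
        have r2 := step2 e₁ (by rw [he₁, degree_mapDomain_perm, he]) b a
          (by rwa [he₁, mapDomain_swap_of_ne _ hab.symm hbc])
          (by rwa [he₁, mapDomain_swap_left])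
        have r3 := step2 e₂ (by rw [he₂, he₁, degree_mapDomain_perm, degree_mapDomain_perm, he])
          c b
          (by rwa [he₂, mapDomain_swap_of_ne _ hbc.symm hac.symm, he₁, mapDomain_swap_right])
          (by rwa [he₂, mapDomain_swap_left, he₁, mapDomain_swap_left])
        have hfin : e₂.mapDomain (Equiv.swap c b) = e.mapDomain (Equiv.swap a b) := by
          rw [he₂, he₁, mapDomain_mapDomain, mapDomain_mapDomain]
          congr 2
          ext i
          simp only [Equiv.Perm.mul_apply, Equiv.swap_apply_def]
          grind
        rw [hfin] at r3
        have := Submodule.add_mem _ (Submodule.add_mem _ r1 r2) r3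
        rwa [sub_add_sub_cancel, sub_add_sub_cancel] at this
  refine Submodule.span_le.2 ?_
  rintro _ ⟨e, σ, he, rfl⟩
  induction σ using Equiv.Perm.swap_induction_on with
  | one => simp
  | swap_mul σ a b hab ih =>
    have := Submodule.add_mem _ ih
      (step3 (e.mapDomain σ) (by rw [degree_mapDomain_perm, he]) a b)
    rwa [sub_add_sub_cancel, mapDomain_mapDomain] at this

end General

end PSI

namespace PSI

section Generic

variable {k : Type} [Field k] {n : ℕ}

theorem eval_one_rename (p : MvPolynomial (Fin n) k) (σ : Equiv.Perm (Fin n)) :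
    eval (fun _ => 1) (rename σ p) = eval (fun _ => 1) p := by
  rw [eval_rename]; rfl

theorem eval_one_eq_zero_of_mem_diffSpan {d : ℕ} {p : MvPolynomial (Fin n) k}
    (hp : p ∈ diffSpan k n d) : eval (fun _ => 1) p = 0 := by
  have : diffSpan k n d ≤ LinearMap.ker (aeval (fun _ => (1 : k)) : _ →ₐ[k] k).toLinearMap := by
    refine Submodule.span_le.2 ?_
    rintro _ ⟨e, σ, he, rfl⟩
    simp [aeval_eq_eval, eval_monomial, Finsupp.prod]
  simpa [aeval_eq_eval] using this hp

theorem exists_diffSpan_le_orbitSpan [CharZero k] {d : ℕ}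
    (hn : Fintype.card (Nat.Partition d) * d + d < n) :
    ∃ f ∈ homogeneousSubmodule (Fin n) k d, eval (fun _ => 1) f ≠ 0 ∧
      diffSpan k n d ≤ orbitSpan f := by
  obtain ⟨ι⟩ : Nonempty (Option (Nat.Partition d × Fin d) ↪ Fin n) := by
    apply Function.Embedding.nonempty_of_card_le
    simp only [Fintype.card_option, Fintype.card_prod, Fintype.card_fin]
    omega
  let A : Nat.Partition d → Finset (Fin n) := fun p =>
    Finset.univ.image fun i : Fin d => ι (some (p, i))
  have hA : ∀ p, (A p).card = d := fun p => by
    rw [Finset.card_image_of_injective, Finset.card_univ, Fintype.card_fin]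
    intro i j h
    simpa using h
  choose E hsupp hdeg htype using fun p => exists_ptype_eq p (A p) (hA p).ge
  have hmem : ∀ p a, E p a ≠ 0 → ∃ i, ι (some (p, i)) = a := fun p a ha => by
    simpa [A] using hsupp p (Finsupp.mem_support_iff.2 ha)
  refine ⟨∑ p, monomial (E p) 1, Submodule.sum_mem _ fun p _ =>
    isHomogeneous_monomial _ (hdeg p), ?_,
    diffSpan_le_orbitSpan_sum E (ι none) hdeg htype (fun p => ?_) (fun p q a hp hq => ?_)
      (by omega)⟩
  · have : Nonempty (Nat.Partition d) := ⟨default⟩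
    simp [eval_monomial, Finsupp.prod]
  · by_contra h
    obtain ⟨i, hi⟩ := hmem p _ h
    simpa using ι.injective hi
  · obtain ⟨i, hi⟩ := hmem p a hp
    obtain ⟨j, hj⟩ := hmem q a hq
    have := ι.injective (hi.trans hj.symm)
    simp only [Option.some.injEq, Prod.mk.injEq] at this
    exact this.1

instance (d : ℕ) : Fintype (DegMon n d) :=
  @Fintype.ofFinite _ (Finsupp.finite_of_degree_eq d).to_subtype

/-- The exponent vector underlying an element of `DegMon n d`. -/
def DegMon.exponent {d : ℕ} (m : DegMon n d) : Fin n →₀ ℕ := Subtype.val m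

/-- The linear form in the coefficients of degree `d` forms given by a linear functional. -/
def linPoly (d : ℕ) (L : MvPolynomial (Fin n) k →ₗ[k] k) : MvPolynomial (DegMon n d) k :=
  ∑ m : DegMon n d, C (L (monomial m.exponent 1)) * X m

theorem eval_linPoly {d : ℕ} (L : MvPolynomial (Fin n) k →ₗ[k] k) {f : MvPolynomial (Fin n) k}
    (hf : f ∈ homogeneousSubmodule (Fin n) k d) :
    eval (fun m : DegMon n d => coeff m.exponent f) (linPoly d L) = L f := by
  have h := eq_on_homogeneous
    (A := ∑ m : DegMon n d, L (monomial m.exponent 1) • lcoeff k m.exponent) (B := L)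
    (fun e he => ?_) hf
  · simpa [linPoly] using h
  · let m₀ : DegMon n d := ⟨e, he⟩
    have hm₀ : m₀.exponent = e := rfl
    rw [LinearMap.sum_apply, Finset.sum_eq_single m₀]
    · simp [hm₀]
    · intro m _ hm
      have : e ≠ m.exponent := fun h => hm (Subtype.ext h.symm)
      simp [coeff_monomial, this]
    · exact fun h => absurd (Finset.mem_univ _) h

theorem exists_polynomial_diffSpan_le_orbitSpan {d : ℕ} {f₀ : MvPolynomial (Fin n) k}
    (hf₀ : f₀ ∈ homogeneousSubmodule (Fin n) k d) (h1 : eval (fun _ => 1) f₀ ≠ 0)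
    (hspan : diffSpan k n d ≤ orbitSpan f₀) :
    ∃ h : MvPolynomial (DegMon n d) k, h ≠ 0 ∧
      ∀ f ∈ homogeneousSubmodule (Fin n) k d, eval (fun m => coeff m.exponent f) h ≠ 0 →
        diffSpan k n d ≤ orbitSpan f := by
  have : Module.Finite k (diffSpan k n d) :=
    Submodule.finiteDimensional_of_le (diffSpan_le_homogeneousSubmodule d)
  let b := Module.finBasis k (diffSpan k n d)
  have hb : ∀ i, ∃ c : Equiv.Perm (Fin n) → k, ∑ σ, c σ • rename σ f₀ = (b i).1 := fun i =>
    (Submodule.mem_span_range_iff_exists_fun k).1 (hspan (b i).2)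
  choose c hc using hb
  have hcsum : ∀ i, ∑ σ, c i σ = 0 := fun i => by
    have h := eval_one_eq_zero_of_mem_diffSpan (b i).2
    rw [← hc i, map_sum] at h
    simp only [smul_eval, eval_one_rename] at h
    rw [← Finset.sum_mul] at h
    exact (mul_eq_zero.1 h).resolve_right h1
  let U := fun i => ∑ σ : Equiv.Perm (Fin n),
    c i σ • (rename σ : MvPolynomial (Fin n) k →ₐ[k] _).toLinearMap
  have hU : ∀ i p, U i p = ∑ σ, c i σ • rename σ p := fun i p => by simp [U]
  have hUmem : ∀ i, ∀ p ∈ homogeneousSubmodule (Fin n) k d, U i p ∈ diffSpan k n d := by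
    intro i p hp
    have : U i p = - ∑ σ, c i σ • (p - rename σ p) := by
      simp only [smul_sub, Finset.sum_sub_distrib, ← Finset.sum_smul, hcsum, hU]
      simp
    rw [this]
    exact Submodule.neg_mem _ (Submodule.sum_mem _ fun σ _ =>
      Submodule.smul_mem _ _ (sub_rename_mem_diffSpan hp σ))
  choose φ hφ using fun j => LinearMap.exists_extend (b.coord j)
  have hφ' : ∀ j (p : diffSpan k n d), φ j p = b.repr p j := fun j p =>
    DFunLike.congr_fun (hφ j) p
  let M : MvPolynomial (Fin n) k → Matrix (Fin _) (Fin _) k :=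
    fun f => Matrix.of fun i j => φ j (U i f)
  let h := (Matrix.of fun i j => linPoly d (φ j ∘ₗ U i)).det
  have heval : ∀ f ∈ homogeneousSubmodule (Fin n) k d,
      eval (fun m => coeff m.exponent f) h = (M f).det := by
    intro f hf
    rw [RingHom.map_det]
    congr 1
    ext i j
    simp only [RingHom.mapMatrix_apply, Matrix.map_apply, Matrix.of_apply, M]
    exact eval_linPoly _ hf
  refine ⟨h, ?_, fun f hf hne => ?_⟩
  · intro h0
    have hM : M f₀ = 1 := by
      ext i j
      simp only [M, Matrix.of_apply, hU, hc, hφ', Module.Basis.repr_self]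
      rw [Finsupp.single_apply, Matrix.one_apply]
    have := heval f₀ hf₀
    rw [h0, hM, Matrix.det_one, map_zero] at this
    exact zero_ne_one this
  · rw [heval f hf] at hne
    have hUM : ∀ i, U i f = ∑ j, M f i j • (b j).1 := by
      intro i
      have := congrArg Subtype.val (b.sum_repr ⟨U i f, hUmem i f hf⟩)
      simp only [AddSubmonoidClass.coe_finsetSum, Submodule.coe_smul] at this
      refine this.symm.trans (Finset.sum_congr rfl fun j _ => ?_)
      rw [← hφ']
      rfl
    have hUorb : ∀ i, U i f ∈ orbitSpan f := fun i => by
      rw [hU]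
      exact Submodule.sum_mem _ fun σ _ => Submodule.smul_mem _ _ (rename_mem_orbitSpan f σ)
    have hbmem : ∀ l, (b l).1 ∈ orbitSpan f := by
      intro l
      have : (b l).1 = ∑ i, (M f)⁻¹ l i • U i f := by
        simp only [hUM, Finset.smul_sum, smul_smul]
        rw [Finset.sum_comm]
        simp only [← Finset.sum_smul, ← Matrix.mul_apply]
        rw [Matrix.nonsing_inv_mul _ (isUnit_iff_ne_zero.2 hne)]
        simp [Matrix.one_apply]
      rw [this]
      exact Submodule.sum_mem _ fun i _ => Submodule.smul_mem _ _ (hUorb i)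
    intro p hp
    have := congrArg Subtype.val (b.sum_repr ⟨p, hp⟩)
    simp only [AddSubmonoidClass.coe_finsetSum, Submodule.coe_smul] at this
    rw [← this]
    exact Submodule.sum_mem _ fun i _ => Submodule.smul_mem _ _ (hbmem i)

end Generic

end PSI

namespace PSI

section TypeIdeal

variable {k : Type} [Field k] {n : ℕ}

open scoped Classical in
variable (k n) in
/-- The sums of the coefficients of a polynomial over the monomials of each type of degree `d`. -/
def typeSum (d : ℕ) : MvPolynomial (Fin n) k →ₗ[k] (Nat.Partition d → k) :=
  (basisMonomials (Fin n) k).constr k fun e =>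
    if e.degree = d then Pi.single (ptype d e) 1 else 0

theorem monomial_eq_smul (e : Fin n →₀ ℕ) (c : k) : monomial e c = c • monomial e (1 : k) := by
  rw [smul_monomial, smul_eq_mul, mul_one]

open scoped Classical in
theorem typeSum_monomial {d : ℕ} {e : Fin n →₀ ℕ} (he : e.degree = d) :
    typeSum k n d (monomial e 1) = Pi.single (ptype d e) 1 := by
  have := (basisMonomials (Fin n) k).constr_basis k (fun e => if e.degree = d then
    (Pi.single (ptype d e) 1 : Nat.Partition d → k) else 0) e
  rw [coe_basisMonomials, if_pos he] at this
  exact this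

theorem typeSum_monomial_of_ne {d : ℕ} {e : Fin n →₀ ℕ} (he : e.degree ≠ d) :
    typeSum k n d (monomial e 1) = 0 := by
  classical
  have := (basisMonomials (Fin n) k).constr_basis k (fun e => if e.degree = d then
    (Pi.single (ptype d e) 1 : Nat.Partition d → k) else 0) e
  rw [coe_basisMonomials, if_neg he] at this
  exact this

theorem typeSum_eq_zero {d : ℕ} {p : MvPolynomial (Fin n) k}
    (h : ∀ e : Fin n →₀ ℕ, e.degree = d → coeff e p = 0) : typeSum k n d p = 0 := by
  rw [p.as_sum, map_sum]
  refine Finset.sum_eq_zero fun e _ => ?_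
  rw [monomial_eq_smul, map_smul]
  by_cases he : e.degree = d
  · rw [h e he, zero_smul]
  · rw [typeSum_monomial_of_ne he, smul_zero]

theorem typeSum_congr {d : ℕ} {p q : MvPolynomial (Fin n) k}
    (h : ∀ e : Fin n →₀ ℕ, e.degree = d → coeff e p = coeff e q) :
    typeSum k n d p = typeSum k n d q := by
  rw [← sub_eq_zero, ← map_sub]
  exact typeSum_eq_zero fun e he => by rw [coeff_sub, h e he, sub_self]

theorem typeSum_rename {d : ℕ} {p : MvPolynomial (Fin n) k}
    (hp : p ∈ homogeneousSubmodule (Fin n) k d) (σ : Equiv.Perm (Fin n)) :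
    typeSum k n d (rename σ p) = typeSum k n d p := by
  refine eq_on_homogeneous (A := typeSum k n d ∘ₗ (rename σ : _ →ₐ[k] _).toLinearMap)
    (fun e he => ?_) hp
  change typeSum k n d (rename σ (monomial e 1)) = _
  rw [rename_monomial, typeSum_monomial he, typeSum_monomial (by rw [degree_mapDomain_perm, he]),
    ptype_mapDomain]

theorem sum_typeSum {d : ℕ} {p : MvPolynomial (Fin n) k}
    (hp : p ∈ homogeneousSubmodule (Fin n) k d) :
    ∑ l, typeSum k n d p l = eval (fun _ => 1) p := by
  have := eq_on_homogeneous (A := (∑ l, LinearMap.proj l) ∘ₗ typeSum k n d)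
    (B := (aeval (fun _ => (1 : k)) : _ →ₐ[k] k).toLinearMap) (fun e he => ?_) hp
  · simpa [aeval_eq_eval] using this
  · simp [typeSum_monomial he, aeval_eq_eval, eval_monomial, Finsupp.prod]

theorem mem_diffSpan_of_typeSum_eq_zero {d : ℕ} (hn : d ≤ n) {p : MvPolynomial (Fin n) k}
    (hp : p ∈ homogeneousSubmodule (Fin n) k d) (h : typeSum k n d p = 0) :
    p ∈ diffSpan k n d := by
  choose E _ hdeg htype using fun l : Nat.Partition d =>
    exists_ptype_eq l (Finset.univ : Finset (Fin n)) (by simpa using hn)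
  let B : MvPolynomial (Fin n) k →ₗ[k] MvPolynomial (Fin n) k :=
    ∑ l, (LinearMap.toSpanSingleton k _ (monomial (E l) 1)) ∘ₗ LinearMap.proj l ∘ₗ typeSum k n d
  have key : p - B p ∈ diffSpan k n d := by
    refine mem_of_homogeneous (S := (diffSpan k n d).comap (LinearMap.id - B)) (fun e he => ?_) hp
    obtain ⟨σ, hσ⟩ := exists_perm_of_ptype_eq he (hdeg (ptype d e)) (htype _).symm
    have : B (monomial e 1) = monomial (E (ptype d e)) 1 := by
      simp only [B, LinearMap.sum_apply, LinearMap.comp_apply, typeSum_monomial he,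
        LinearMap.proj_apply, LinearMap.toSpanSingleton_apply]
      rw [Finset.sum_eq_single (ptype d e)]
      · simp
      · intro l _ hl
        simp [hl]
      · exact fun h => absurd (Finset.mem_univ _) h
    change monomial e 1 - B (monomial e 1) ∈ diffSpan k n d
    rw [this]
    exact Submodule.subset_span ⟨e, σ, he, by rw [hσ]⟩
  have hB : B p = 0 := by simp [B, h]
  rwa [hB, sub_zero] at key

theorem coeff_X_mul_of_degree_le {d : ℕ} {p : MvPolynomial (Fin n) k}
    (h : ∀ e : Fin n →₀ ℕ, e.degree < d → coeff e p = 0) (i : Fin n) {e : Fin n →₀ ℕ}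
    (he : e.degree ≤ d) : coeff e (X i * p) = 0 := by
  classical
  rw [coeff_X_mul']
  split_ifs with hi
  · apply h
    have hle : Finsupp.single i 1 ≤ e := by
      rw [Finsupp.single_le_iff]; exact Nat.one_le_iff_ne_zero.2 (Finsupp.mem_support_iff.1 hi)
    have := congrArg Finsupp.degree (tsub_add_cancel_of_le hle)
    rw [map_add, Finsupp.degree_single] at this
    omega
  · rfl

/-- The polynomials with no terms of degree below `d` whose sums of coefficients over the types of
degree `d` are proportional to `t`. -/
def typeIdeal (d : ℕ) (t : Nat.Partition d → k) : Ideal (MvPolynomial (Fin n) k) where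
  carrier := {p | (∀ e : Fin n →₀ ℕ, e.degree < d → coeff e p = 0) ∧
    typeSum k n d p ∈ Submodule.span k {t}}
  zero_mem' := ⟨fun _ _ => coeff_zero _, by rw [map_zero]; exact Submodule.zero_mem _⟩
  add_mem' := by
    rintro p q ⟨hp, hp'⟩ ⟨hq, hq'⟩
    refine ⟨fun e he => by rw [coeff_add, hp e he, hq e he, add_zero], ?_⟩
    rw [map_add]
    exact Submodule.add_mem _ hp' hq'
  smul_mem' := by
    intro a p hp
    induction a using MvPolynomial.induction_on generalizing p with
    | C c =>
      rw [smul_eq_mul, ← smul_eq_C_mul]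
      refine ⟨fun e he => by rw [coeff_smul, hp.1 e he, smul_zero], ?_⟩
      rw [map_smul]
      exact Submodule.smul_mem _ _ hp.2
    | add a b ha hb =>
      have ha := ha hp
      have hb := hb hp
      refine ⟨fun e he => by rw [add_smul, coeff_add, ha.1 e he, hb.1 e he, add_zero], ?_⟩
      rw [add_smul, map_add]
      exact Submodule.add_mem _ ha.2 hb.2
    | mul_X a i ha =>
      rw [smul_eq_mul, mul_assoc]
      refine ha ⟨fun e he => coeff_X_mul_of_degree_le hp.1 i he.le, ?_⟩
      rw [typeSum_eq_zero fun e he => coeff_X_mul_of_degree_le hp.1 i he.le]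
      exact Submodule.zero_mem _

theorem mem_typeIdeal {d : ℕ} {t : Nat.Partition d → k} {p : MvPolynomial (Fin n) k} :
    p ∈ typeIdeal d t ↔ (∀ e : Fin n →₀ ℕ, e.degree < d → coeff e p = 0) ∧
      typeSum k n d p ∈ Submodule.span k {t} := Iff.rfl

theorem card_support_le_degree (m : Fin n →₀ ℕ) : m.support.card ≤ m.degree := by
  rw [Finset.card_eq_sum_ones, Finsupp.degree_apply]
  exact Finset.sum_le_sum fun i hi => Nat.one_le_iff_ne_zero.2 (Finsupp.mem_support_iff.1 hi)

theorem typeOf_eq_replicate {m : Fin n →₀ ℕ} (h : m.support.card = m.degree) :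
    typeOf n m = Multiset.replicate m.degree 1 := by
  rw [Multiset.eq_replicate]
  refine ⟨by rw [typeOf, Multiset.card_map, Finset.card_val, h], fun b hb => ?_⟩
  obtain ⟨i, hi, rfl⟩ := Multiset.mem_map.1 hb
  rw [Finset.card_eq_sum_ones, Finsupp.degree_apply, Finset.sum_eq_sum_iff_of_le
    fun i hi => Nat.one_le_iff_ne_zero.2 (Finsupp.mem_support_iff.1 hi)] at h
  exact (h i hi).symm

theorem exists_eq_add_single {m : Fin n →₀ ℕ} {i : Fin n} (hi : m i ≠ 0) :
    ∃ e : Fin n →₀ ℕ, m = e + Finsupp.single i 1 ∧ m.degree = e.degree + 1 := by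
  have hle : Finsupp.single i 1 ≤ m := by
    rw [Finsupp.single_le_iff]; exact Nat.one_le_iff_ne_zero.2 hi
  refine ⟨m - Finsupp.single i 1, (tsub_add_cancel_of_le hle).symm, ?_⟩
  conv_lhs => rw [← tsub_add_cancel_of_le hle]
  rw [map_add, Finsupp.degree_single]

theorem X_mul_monomial (i : Fin n) (e : Fin n →₀ ℕ) :
    X i * monomial e (1 : k) = monomial (e + Finsupp.single i 1) 1 := by
  rw [X, monomial_mul, one_mul, add_comm]

/-- Modulo the differences of conjugate monomials of degree `d`, all monomials of degree `d + 1`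
agree. -/
theorem monomial_sub_monomial_mem {d : ℕ} (hd : 2 ≤ d) (hn : d < n)
    {I : Ideal (MvPolynomial (Fin n) k)} (hI : diffSpan k n d ≤ I.restrictScalars k)
    {m m' : Fin n →₀ ℕ} (hm : m.degree = d + 1) (hm' : m'.degree = d + 1) :
    monomial m (1 : k) - monomial m' 1 ∈ I := by
  have trans : ∀ {a b c : Fin n →₀ ℕ}, monomial a (1 : k) - monomial b 1 ∈ I →
      monomial b (1 : k) - monomial c 1 ∈ I → monomial a (1 : k) - monomial c 1 ∈ I := by
    intro a b c h1 h2
    have := I.add_mem h1 h2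
    rwa [sub_add_sub_cancel] at this
  have move : ∀ (e : Fin n →₀ ℕ) (σ : Equiv.Perm (Fin n)) (i : Fin n), e.degree = d →
      monomial (e + Finsupp.single i 1) (1 : k) -
        monomial (e.mapDomain σ + Finsupp.single i 1) 1 ∈ I := by
    intro e σ i he
    rw [← X_mul_monomial, ← X_mul_monomial, ← mul_sub]
    exact I.mul_mem_left _ (hI (Submodule.subset_span ⟨e, σ, he, rfl⟩))
  have perm : ∀ (m : Fin n →₀ ℕ) (σ : Equiv.Perm (Fin n)), m.degree = d + 1 →
      3 ≤ m.support.card → monomial m (1 : k) - monomial (m.mapDomain σ) 1 ∈ I := by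
    have aux : ∀ (m : Fin n →₀ ℕ) (a b : Fin n), m.degree = d + 1 → 3 ≤ m.support.card →
        monomial m (1 : k) - monomial (m.mapDomain (Equiv.swap a b)) 1 ∈ I := by
      intro m a b hm h3
      obtain ⟨i, hi, hab⟩ : ∃ i ∈ m.support, i ∉ ({a, b} : Finset (Fin n)) := by
        by_contra! h
        have := Finset.card_le_card h
        have := Finset.card_le_two (a := a) (b := b)
        omega
      simp only [Finset.mem_insert, Finset.mem_singleton, not_or] at hab
      obtain ⟨e, rfl, he⟩ := exists_eq_add_single (Finsupp.mem_support_iff.1 hi)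
      have := move e (Equiv.swap a b) i (by omega)
      rwa [Finsupp.mapDomain_add, Finsupp.mapDomain_single,
        Equiv.swap_apply_of_ne_of_ne hab.1 hab.2]
    intro m σ hm h3
    induction σ using Equiv.Perm.swap_induction_on with
    | one => simp
    | swap_mul σ a b _ ih =>
      have := aux (m.mapDomain σ) a b (by rw [degree_mapDomain_perm, hm]) (by
        have h : (typeOf n (m.mapDomain σ)).card = (typeOf n m).card := by rw [typeOf_mapDomain]
        simp only [typeOf, Multiset.card_map, Finset.card_val] at h
        omega)
      rw [mapDomain_mapDomain] at this
      exact trans ih this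
  have spread : ∀ (N : ℕ) (m : Fin n →₀ ℕ), m.degree = d + 1 → m.support.card + N = d + 1 →
      ∃ m' : Fin n →₀ ℕ, m'.degree = d + 1 ∧ m'.support.card = d + 1 ∧
        monomial m (1 : k) - monomial m' 1 ∈ I := by
    intro N
    induction N with
    | zero => exact fun m hm hc => ⟨m, hm, by omega, by simp⟩
    | succ N ih =>
      intro m hm hc
      obtain ⟨a, ha, ha2⟩ : ∃ a ∈ m.support, 1 < m a := by
        apply Finset.exists_lt_of_sum_lt
        rw [← Finset.card_eq_sum_ones, ← Finsupp.degree_apply]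
        omega
      obtain ⟨b, hb⟩ : ∃ b, b ∉ m.support := by
        by_contra! h
        have := Finset.card_le_card (fun i _ => h i : Finset.univ ⊆ m.support)
        rw [Finset.card_univ, Fintype.card_fin] at this
        omega
      have hb0 : m b = 0 := by simpa using hb
      have hab : a ≠ b := by rintro rfl; exact hb ha
      obtain ⟨e, rfl, he⟩ := exists_eq_add_single (Finsupp.mem_support_iff.1 ha)
      set m₂ := e.mapDomain (Equiv.swap a b) + Finsupp.single a 1 with hm₂
      have hea : e a ≠ 0 := by
        rw [Finsupp.add_apply, Finsupp.single_eq_same] at ha2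
        omega
      have hs : m₂.support = insert b (e + Finsupp.single a 1).support := by
        ext i
        simp only [Finset.mem_insert, Finsupp.mem_support_iff, hm₂, Finsupp.add_apply]
        rcases eq_or_ne i a with rfl | hia
        · simp
        rcases eq_or_ne i b with rfl | hib
        · simp [hea]
        · simp [mapDomain_swap_of_ne _ hia hib, hib]
      obtain ⟨m', h1, h2, h3⟩ := ih m₂
        (by rw [hm₂, map_add, degree_mapDomain_perm, Finsupp.degree_single]; omega)
        (by rw [hs, Finset.card_insert_of_notMem hb]; omega)
      exact ⟨m', h1, h2, trans (move e (Equiv.swap a b) a (by omega)) h3⟩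
  obtain ⟨u, hu, hu', hmu⟩ := spread (d + 1 - m.support.card) m hm
    (by have := card_support_le_degree m; omega)
  obtain ⟨v, hv, hv', hmv⟩ := spread (d + 1 - m'.support.card) m' hm'
    (by have := card_support_le_degree m'; omega)
  obtain ⟨σ, rfl⟩ := exists_perm_of_typeOf_eq (e := u) (e' := v)
    (by rw [typeOf_eq_replicate (by omega), typeOf_eq_replicate (by omega), hu, hv])
  refine trans (trans hmu (perm u σ hu (by omega))) ?_
  rw [← neg_sub]
  exact I.neg_mem hmv

theorem monomial_mem_of_lt_degree {d : ℕ} (hd : 2 ≤ d) (hn : d < n)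
    {I : Ideal (MvPolynomial (Fin n) k)} (hI : diffSpan k n d ≤ I.restrictScalars k)
    {f : MvPolynomial (Fin n) k} (hf : f ∈ homogeneousSubmodule (Fin n) k d) (hfI : f ∈ I)
    (h1 : eval (fun _ => 1) f ≠ 0) {m : Fin n →₀ ℕ} (hm : d < m.degree) :
    monomial m (1 : k) ∈ I := by
  have top : ∀ m : Fin n →₀ ℕ, m.degree = d + 1 → monomial m (1 : k) ∈ I := by
    intro m hm
    let i : Fin n := ⟨0, by omega⟩
    let π := (Ideal.Quotient.mkₐ k I).toLinearMap
    have h := eq_on_homogeneous (A := π ∘ₗ LinearMap.mulLeft k (X i))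
      (B := (LinearMap.toSpanSingleton k _ (π (monomial m 1))) ∘ₗ
        (aeval (fun _ => (1 : k)) : _ →ₐ[k] k).toLinearMap) (fun e he => ?_) hf
    · have h0 : π (X i * f) = 0 := Ideal.Quotient.eq_zero_iff_mem.2 (I.mul_mem_left _ hfI)
      change π (X i * f) = (aeval (fun _ => (1 : k)) f) • π (monomial m 1) at h
      rw [h0, aeval_eq_eval] at h
      have := (smul_eq_zero.1 h.symm).resolve_left h1
      exact Ideal.Quotient.eq_zero_iff_mem.1 this
    · change π (X i * monomial e 1) = (aeval (fun _ => (1 : k)) (monomial e (1 : k))) •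
        π (monomial m 1)
      rw [X_mul_monomial]
      have : (aeval (fun _ => (1 : k)) (monomial e (1 : k)) : k) = 1 := by
        simp [aeval_monomial, Finsupp.prod]
      rw [this, one_smul]
      exact Ideal.Quotient.eq.2 (monomial_sub_monomial_mem hd hn hI
        (by rw [map_add, Finsupp.degree_single, he]) hm)
  obtain ⟨N, hN⟩ := Nat.exists_eq_add_of_lt hm
  induction N generalizing m with
  | zero => exact top m hN
  | succ N ih =>
    have : m ≠ 0 := by rintro rfl; simp at hN
    obtain ⟨i, hi⟩ := Finsupp.ne_iff.1 this
    obtain ⟨e, rfl, he⟩ := exists_eq_add_single hi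
    rw [← X_mul_monomial]
    exact I.mul_mem_left _ (ih (by omega) (by omega))

theorem psi_eq_typeIdeal {d : ℕ} (hd : 2 ≤ d) (hn : d < n) {f : MvPolynomial (Fin n) k}
    (hf : f ∈ homogeneousSubmodule (Fin n) k d) (h1 : eval (fun _ => 1) f ≠ 0)
    (hspan : diffSpan k n d ≤ orbitSpan f) :
    psi k n f = typeIdeal d (typeSum k n d f) := by
  have horb : orbitSpan f ≤ (psi k n f).restrictScalars k := by
    refine Submodule.span_le.2 ?_
    rintro _ ⟨σ, rfl⟩
    exact Ideal.subset_span ⟨σ, rfl⟩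
  apply le_antisymm
  · refine Ideal.span_le.2 ?_
    rintro _ ⟨σ, rfl⟩
    refine ⟨fun e he => IsHomogeneous.coeff_eq_zero (IsHomogeneous.rename_isHomogeneous hf) he.ne,
      ?_⟩
    rw [typeSum_rename hf]
    exact Submodule.mem_span_singleton_self _
  · rintro p ⟨hp, hp'⟩
    obtain ⟨c, hc⟩ := Submodule.mem_span_singleton.1 hp'
    have hlow : homogeneousComponent d p ∈ psi k n f := by
      have hmem : homogeneousComponent d p - c • f ∈ diffSpan k n d := by
        refine mem_diffSpan_of_typeSum_eq_zero hn.le (Submodule.sub_mem _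
          (homogeneousComponent_isHomogeneous d p) (Submodule.smul_mem _ _ hf)) ?_
        rw [map_sub, map_smul, hc, sub_eq_zero]
        exact typeSum_congr fun e he => by rw [coeff_homogeneousComponent, if_pos he]
      have := Submodule.add_mem _ (horb (hspan hmem))
        (Submodule.smul_mem _ c (horb (self_mem_orbitSpan f)))
      rwa [sub_add_cancel] at this
    have hhigh : p - homogeneousComponent d p ∈ (psi k n f).restrictScalars k := by
      rw [(p - homogeneousComponent d p).as_sum]
      refine Submodule.sum_mem _ fun e he => ?_
      rw [mem_support_iff, coeff_sub, coeff_homogeneousComponent] at he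
      rw [monomial_eq_smul]
      refine Submodule.smul_mem _ _ (monomial_mem_of_lt_degree hd hn (hspan.trans horb) hf
        (horb (self_mem_orbitSpan f)) h1 ?_)
      by_contra hle
      rcases (not_lt.1 hle).lt_or_eq with hlt | heq
      · simp [hp e hlt, hlt.ne] at he
      · simp [heq] at he
    have := (psi k n f).add_mem hhigh hlow
    rwa [sub_add_cancel] at this

end TypeIdeal

end PSI

namespace PSI

section Quotient

variable {k : Type} [Field k] {n : ℕ}

theorem isHomog_typeIdeal (d : ℕ) (t : Nat.Partition d → k) : IsHomog k n (typeIdeal d t) := by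
  intro f hf m
  obtain ⟨h1, h2⟩ := mem_typeIdeal.1 hf
  refine mem_typeIdeal.2 ⟨fun e he => ?_, ?_⟩
  · rw [coeff_homogeneousComponent, h1 e he, ite_self]
  · by_cases hm : m = d
    · rwa [typeSum_congr (q := f) fun e he => by
        rw [coeff_homogeneousComponent, if_pos (he.trans hm.symm)]]
    · rw [typeSum_eq_zero fun e he => by
        rw [coeff_homogeneousComponent, if_neg (by omega)]]
      exact Submodule.zero_mem _

theorem mem_typeIdeal_of_lt {d i : ℕ} (t : Nat.Partition d → k) (hi : d < i)
    {p : MvPolynomial (Fin n) k} (hp : p ∈ homogeneousSubmodule (Fin n) k i) :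
    p ∈ typeIdeal d t := by
  refine mem_typeIdeal.2 ⟨fun e he => IsHomogeneous.coeff_eq_zero hp (by omega), ?_⟩
  rw [typeSum_eq_zero fun e he => IsHomogeneous.coeff_eq_zero hp (by omega)]
  exact Submodule.zero_mem _

theorem mem_typeIdeal_iff_of_homogeneous {d : ℕ} {t : Nat.Partition d → k}
    {p : MvPolynomial (Fin n) k} (hp : p ∈ homogeneousSubmodule (Fin n) k d) :
    p ∈ typeIdeal d t ↔ typeSum k n d p ∈ Submodule.span k {t} :=
  mem_typeIdeal.trans <| and_iff_right fun e he => IsHomogeneous.coeff_eq_zero hp (by omega)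

theorem eq_zero_of_mem_typeIdeal {d i : ℕ} {t : Nat.Partition d → k} (hi : i < d)
    {p : MvPolynomial (Fin n) k} (hp : p ∈ homogeneousSubmodule (Fin n) k i)
    (hpI : p ∈ typeIdeal d t) : p = 0 := by
  ext e
  by_cases he : e.degree = i
  · simp [(mem_typeIdeal.1 hpI).1 e (by omega)]
  · simp [IsHomogeneous.coeff_eq_zero hp he]

theorem X_mul_mem_homogeneousSubmodule {i : ℕ} {p : MvPolynomial (Fin n) k}
    (hp : p ∈ homogeneousSubmodule (Fin n) k i) (j : Fin n) :
    X j * p ∈ homogeneousSubmodule (Fin n) k (i + 1) := by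
  rw [add_comm]
  exact (isHomogeneous_X k j).mul hp

theorem map_typeSum {d : ℕ} (hn : d ≤ n) :
    (homogeneousSubmodule (Fin n) k d).map (typeSum k n d) = ⊤ := by
  classical
  rw [eq_top_iff]
  intro v _
  have hv : v = ∑ l, v l • (Pi.single l 1 : Nat.Partition d → k) := by
    ext m
    simp [Finset.sum_apply, Pi.single_apply]
  rw [hv]
  refine Submodule.sum_mem _ fun l _ => Submodule.smul_mem _ _ ?_
  obtain ⟨e, -, he, hl⟩ := exists_ptype_eq l (Finset.univ : Finset (Fin n)) (by simpa using hn)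
  refine ⟨monomial e 1, isHomogeneous_monomial _ he, ?_⟩
  rw [typeSum_monomial he, hl]

theorem finrank_map_eq_of_mem_iff {V W W' : Type*} [AddCommGroup V] [Module k V]
    [AddCommGroup W] [Module k W] [AddCommGroup W'] [Module k W'] (U : Submodule k V)
    [Module.Finite k U] {f : V →ₗ[k] W} {g : V →ₗ[k] W'}
    (h : ∀ x ∈ U, f x = 0 ↔ g x = 0) :
    Module.finrank k (U.map f) = Module.finrank k (U.map g) := by
  have hf := (f.domRestrict U).finrank_range_add_finrank_ker
  have hg := (g.domRestrict U).finrank_range_add_finrank_ker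
  have hk : LinearMap.ker (f.domRestrict U) = LinearMap.ker (g.domRestrict U) := by
    ext x
    exact h x x.2
  rw [LinearMap.range_domRestrict] at hf hg
  rw [hk] at hf
  omega

theorem hfA_typeIdeal_of_lt {d i : ℕ} (t : Nat.Partition d → k) (hi : i < d) :
    hfA k n (typeIdeal d t) i = rdim k n i := by
  have := finrank_map_eq_of_mem_iff (homogeneousSubmodule (Fin n) k i)
    (f := (Ideal.Quotient.mkₐ k (typeIdeal d t)).toLinearMap) (g := LinearMap.id)
    fun p hp => ⟨fun h => eq_zero_of_mem_typeIdeal hi hp (Ideal.Quotient.eq_zero_iff_mem.1 h),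
      fun h => by rw [LinearMap.id_apply] at h; rw [h, map_zero]⟩
  rwa [Submodule.map_id] at this

theorem Agr_typeIdeal_of_lt {d i : ℕ} (t : Nat.Partition d → k) (hi : d < i) :
    Agr k n (typeIdeal d t) i = ⊥ := by
  rw [eq_bot_iff]
  rintro _ ⟨p, hp, rfl⟩
  exact Ideal.Quotient.eq_zero_iff_mem.2 (mem_typeIdeal_of_lt t hi hp)

theorem hfA_typeIdeal_self {d : ℕ} (hn : d ≤ n) {t : Nat.Partition d → k} (ht : t ≠ 0) :
    hfA k n (typeIdeal d t) d + 1 = Pnum d := by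
  have := finrank_map_eq_of_mem_iff (homogeneousSubmodule (Fin n) k d)
    (f := (Ideal.Quotient.mkₐ k (typeIdeal d t)).toLinearMap)
    (g := (Submodule.span k {t}).mkQ ∘ₗ typeSum k n d)
    fun p hp => by
      rw [LinearMap.comp_apply, Submodule.mkQ_apply, Submodule.Quotient.mk_eq_zero,
        ← mem_typeIdeal_iff_of_homogeneous hp]
      exact Ideal.Quotient.eq_zero_iff_mem
  rw [Submodule.map_comp, map_typeSum hn, Submodule.map_top, Submodule.range_mkQ,
    finrank_top] at this
  have h2 := Submodule.finrank_quotient_add_finrank (Submodule.span k {t})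
  rw [finrank_span_singleton ht, Module.finrank_fintype_fun_eq_card] at h2
  rw [Pnum, ← h2, ← this]
  rfl

theorem mk_mem_socSub {I : Ideal (MvPolynomial (Fin n) k)} {p : MvPolynomial (Fin n) k} :
    Ideal.Quotient.mk I p ∈ socSub k n I ↔ ∀ j, X j * p ∈ I := by
  simp only [socSub, Submodule.mem_iInf, LinearMap.mem_ker, LinearMap.mulLeft_apply, ← map_mul,
    Ideal.Quotient.eq_zero_iff_mem]

theorem Agr_le_socSub {d : ℕ} (t : Nat.Partition d → k) :
    Agr k n (typeIdeal d t) d ≤ socSub k n (typeIdeal d t) := by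
  rintro _ ⟨p, hp, rfl⟩
  exact mk_mem_socSub.2 fun j =>
    mem_typeIdeal_of_lt t d.lt_succ_self (X_mul_mem_homogeneousSubmodule hp j)

theorem socdim_typeIdeal_self {d : ℕ} (t : Nat.Partition d → k) :
    socdim k n (typeIdeal d t) d = hfA k n (typeIdeal d t) d := by
  rw [socdim, inf_eq_left.2 (Agr_le_socSub t), hfA]

theorem socdim_typeIdeal_of_lt {d j : ℕ} (t : Nat.Partition d → k) (hj : d < j) :
    socdim k n (typeIdeal d t) j = 0 := by
  rw [socdim, Agr_typeIdeal_of_lt t hj, bot_inf_eq, finrank_bot]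

theorem socdim_typeIdeal_of_add_one_lt {d j : ℕ} (hn : 0 < n) (t : Nat.Partition d → k)
    (hj : j + 1 < d) : socdim k n (typeIdeal d t) j = 0 := by
  have : Agr k n (typeIdeal d t) j ⊓ socSub k n (typeIdeal d t) = ⊥ := by
    rw [eq_bot_iff]
    rintro _ ⟨⟨p, hp, rfl⟩, hs⟩
    have h0 := eq_zero_of_mem_typeIdeal hj (X_mul_mem_homogeneousSubmodule hp _)
      (mk_mem_socSub.1 hs ⟨0, hn⟩)
    rw [(mul_eq_zero.1 h0).resolve_left (X_ne_zero _), map_zero]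
    exact Submodule.zero_mem _
  rw [socdim, this, finrank_bot]

theorem finite_quotient_typeIdeal (d : ℕ) (t : Nat.Partition d → k) :
    Module.Finite k (MvPolynomial (Fin n) k ⧸ typeIdeal d t) := by
  refine Module.Finite.of_surjective ((Ideal.Quotient.mkₐ k (typeIdeal d t)).toLinearMap ∘ₗ
    (restrictTotalDegree (Fin n) k d).subtype) fun y => ?_
  obtain ⟨p, rfl⟩ := Ideal.Quotient.mk_surjective y
  refine ⟨∑ i : Fin (d + 1), ⟨homogeneousComponent i p, ?_⟩, ?_⟩
  · rw [mem_restrictTotalDegree]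
    exact (homogeneousComponent_isHomogeneous _ p).totalDegree_le.trans (by omega)
  · rw [LinearMap.comp_apply, Submodule.subtype_apply, AddSubmonoidClass.coe_finsetSum]
    have key : ∀ e : Fin n →₀ ℕ, e.degree ≤ d →
        coeff e (∑ i : Fin (d + 1), homogeneousComponent i p - p) = 0 := by
      intro e he
      rw [coeff_sub, coeff_sum, Finset.sum_eq_single ⟨e.degree, Nat.lt_succ_of_le he⟩,
        coeff_homogeneousComponent, if_pos rfl, sub_self]
      · intro i _ hi
        exact (coeff_homogeneousComponent _ _ _).trans (if_neg fun h => hi (Fin.ext h.symm))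
      · exact fun h => absurd (Finset.mem_univ _) h
    refine Ideal.Quotient.eq.2 (mem_typeIdeal.2 ⟨fun e he => key e he.le, ?_⟩)
    rw [typeSum_eq_zero fun e he => key e he.le]
    exact Submodule.zero_mem _

theorem isArtinianRing_quotient_typeIdeal (d : ℕ) (t : Nat.Partition d → k) :
    IsArtinianRing (MvPolynomial (Fin n) k ⧸ typeIdeal d t) :=
  have := finite_quotient_typeIdeal (n := n) d t
  IsArtinianRing.of_finite k _

theorem sdeg_typeIdeal {d : ℕ} {t : Nat.Partition d → k}
    (h : hfA k n (typeIdeal d t) d ≠ 0) : sdeg k n (typeIdeal d t) = d := by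
  refine IsGreatest.csSup_eq ⟨fun h0 => h ?_, fun i hi => ?_⟩
  · rw [inf_eq_left.2 (Agr_le_socSub t)] at h0
    rw [hfA, h0, finrank_bot]
  · by_contra hlt
    exact hi (by rw [Agr_typeIdeal_of_lt t (not_le.1 hlt), bot_inf_eq])

theorem tdeg_typeIdeal {d : ℕ} (hn : d ≤ n) {t : Nat.Partition d → k} (ht : t ≠ 0) :
    tdeg k n (typeIdeal d t) = d := by
  refine IsLeast.csInf_eq ⟨fun h0 => ht ?_, fun i hi => ?_⟩
  · obtain ⟨p, hp, rfl⟩ := (map_typeSum (k := k) hn).ge (Submodule.mem_top (x := t))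
    have hmem : p ∈ Igrade k n (typeIdeal d (typeSum k n d p)) d :=
      ⟨hp, (mem_typeIdeal_iff_of_homogeneous hp).2 (Submodule.mem_span_singleton_self _)⟩
    rw [h0, Submodule.mem_bot] at hmem
    rw [hmem, map_zero]
  · by_contra hlt
    refine hi (eq_bot_iff.2 ?_)
    rintro p ⟨hp, hpI⟩
    exact eq_zero_of_mem_typeIdeal (not_le.1 hlt) hp hpI

end Quotient

end PSI

namespace PSI

section Relations

variable {k : Type} [Field k] {n : ℕ}

theorem exists_perm_apply_eq {α : Type*} {a b a' b' : α} (h : a ≠ b) (h' : a' ≠ b') :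
    ∃ σ : Equiv.Perm α, σ a' = a ∧ σ b' = b := by
  classical
  refine ⟨Equiv.swap (Equiv.swap a' a b') b * Equiv.swap a' a, ?_, ?_⟩
  · rw [Equiv.Perm.mul_apply, Equiv.swap_apply_left, Equiv.swap_apply_of_ne_of_ne _ h]
    intro hab
    exact h' ((Equiv.swap a' a).injective (by rw [← hab, Equiv.swap_apply_left]))
  · rw [Equiv.Perm.mul_apply, Equiv.swap_apply_left]

/-- If symmetric functions `g j` on exponent vectors of degree `m + 1` satisfy the relation
`∑ j, g j (e + ε_j) = 0` for all `e` of degree `m`, their differences are constant. -/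
theorem sub_eq_sub_of_sum_add_single_eq_zero {α : Type*} [AddCommGroup α] {m : ℕ}
    {g : Fin n → (Fin n →₀ ℕ) → α}
    (hinv : ∀ j (e : Fin n →₀ ℕ) (σ : Equiv.Perm (Fin n)), e.degree = m + 1 →
      g j (e.mapDomain σ) = g j e)
    (hsum : ∀ e : Fin n →₀ ℕ, e.degree = m → ∑ j, g j (e + Finsupp.single j 1) = 0)
    (a b : Fin n) {e e' : Fin n →₀ ℕ} (he : e.degree = m + 1) (he' : e'.degree = m + 1) :
    g a e - g b e = g a e' - g b e' := by
  rcases eq_or_ne a b with rfl | hab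
  · simp
  have move (σ : Equiv.Perm (Fin n)) (e : Fin n →₀ ℕ) (he : e.degree = m) (i j : Fin n) :
      g j (e.mapDomain σ + Finsupp.single (σ i) 1) = g j (e + Finsupp.single i 1) := by
    rw [← hinv j (e + Finsupp.single i 1) σ (by rw [map_add, Finsupp.degree_single, he]),
      Finsupp.mapDomain_add, Finsupp.mapDomain_single]
  have key (e : Fin n →₀ ℕ) (he : e.degree = m) :
      g a (e + Finsupp.single a 1) - g b (e + Finsupp.single a 1) =
        g a (e + Finsupp.single b 1) - g b (e + Finsupp.single b 1) := by
    have h1 := hsum (e.mapDomain (Equiv.swap a b)) (by rw [degree_mapDomain_perm, he])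
    have h2 : ∑ j, g j (e + Finsupp.single (Equiv.swap a b j) 1) = 0 := by
      rw [← h1]
      refine Finset.sum_congr rfl fun j _ => ?_
      rw [← move (Equiv.swap a b) e he, Equiv.swap_apply_self]
    have h3 := congrArg₂ (· - ·) (hsum e he) h2
    simp only [← Finset.sum_sub_distrib] at h3
    rw [Finset.sum_eq_add a b hab] at h3
    · rw [Equiv.swap_apply_left, Equiv.swap_apply_right, sub_zero] at h3
      rw [← sub_eq_zero, ← h3]
      abel
    · rintro j - ⟨hja, hjb⟩
      rw [Equiv.swap_apply_of_ne_of_ne hja hjb, sub_self]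
    · exact fun h => absurd (Finset.mem_univ _) h
    · exact fun h => absurd (Finset.mem_univ _) h
  refine eq_of_forall_add_single_eq (g := fun e => g a e - g b e) (fun e he a' b' => ?_) he he'
  rcases eq_or_ne a' b' with rfl | hab'
  · rfl
  obtain ⟨σ, ha, hb⟩ := exists_perm_apply_eq hab hab'
  have := key (e.mapDomain σ) (by rw [degree_mapDomain_perm, he])
  have hma := move σ e he a'
  have hmb := move σ e he b'
  rw [ha] at hma
  rw [hb] at hmb
  rwa [hma, hma, hmb, hmb] at this

/-- The coefficients of the contraction of `G` as a linear function of the contracting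
polynomial. -/
def contractCoeff (e : Fin n →₀ ℕ) (G : MvPolynomial (Fin n) k) : MvPolynomial (Fin n) k →ₗ[k] k :=
  (basisMonomials (Fin n) k).constr k fun c => coeff (c + e) G

theorem contractCoeff_monomial (e : Fin n →₀ ℕ) (G : MvPolynomial (Fin n) k) (c : Fin n →₀ ℕ) :
    contractCoeff e G (monomial c 1) = coeff (c + e) G := by
  have := (basisMonomials (Fin n) k).constr_basis k (fun c => coeff (c + e) G) c
  rwa [coe_basisMonomials] at this

theorem coeff_contract (e : Fin n →₀ ℕ) (p G : MvPolynomial (Fin n) k) :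
    coeff e (contract k n p G) = contractCoeff e G p := by
  conv_rhs => rw [p.as_sum, map_sum]
  rw [contract, coeff_sum]
  refine Finset.sum_congr rfl fun c _ => ?_
  rw [monomial_eq_smul, map_smul, contractCoeff_monomial, coeff_smul, coeff_divMonomial]

theorem exists_eq_single_of_degree_eq_one {e : Fin n →₀ ℕ} (he : e.degree = 1) :
    ∃ j, e = Finsupp.single j 1 := by
  have : e ≠ 0 := by rintro rfl; simp at he
  obtain ⟨j, hj⟩ := Finsupp.ne_iff.1 this
  obtain ⟨c, rfl, hc⟩ := exists_eq_add_single hj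
  have : c = 0 := (Finsupp.degree_eq_zero_iff c).1 (by omega)
  exact ⟨j, by rw [this, zero_add]⟩

theorem eq_sum_smul_X {l : MvPolynomial (Fin n) k} (hl : l ∈ homogeneousSubmodule (Fin n) k 1) :
    l = ∑ j, coeff (Finsupp.single j 1) l • X j := by
  have := eq_on_homogeneous (A := LinearMap.id)
    (B := ∑ j, (lcoeff k (Finsupp.single j 1)).smulRight (X j : MvPolynomial (Fin n) k))
    (fun e he => ?_) hl
  · simpa using this
  · obtain ⟨i, rfl⟩ := exists_eq_single_of_degree_eq_one he
    simp [coeff_monomial, Finsupp.single_left_inj, X]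

theorem mapDomain_coeff_of_mem_perpSub {d : ℕ} {t : Nat.Partition d → k}
    {G : MvPolynomial (Fin n) k} (hG : G ∈ perpSub k n (typeIdeal d t) d) {e : Fin n →₀ ℕ}
    (he : e.degree = d) (σ : Equiv.Perm (Fin n)) : coeff (e.mapDomain σ) G = coeff e G := by
  have he' : (e.mapDomain σ).degree = d := by rw [degree_mapDomain_perm, he]
  have hI : monomial (e.mapDomain σ) (1 : k) - monomial e 1 ∈ typeIdeal d t := by
    rw [mem_typeIdeal_iff_of_homogeneous (Submodule.sub_mem _ (isHomogeneous_monomial _ he')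
      (isHomogeneous_monomial _ he)), map_sub, typeSum_monomial he, typeSum_monomial he',
      ptype_mapDomain, sub_self]
    exact Submodule.zero_mem _
  have := congrArg (coeff 0) (hG.2 _ hI)
  rwa [coeff_contract, map_sub, contractCoeff_monomial, contractCoeff_monomial, coeff_zero,
    add_zero, add_zero, sub_eq_zero] at this

theorem eq_zero_of_mem_perpSub {d : ℕ} (hn : d ≤ n) {t : Nat.Partition d → k}
    (ht : ∑ l, t l ≠ 0) {G : MvPolynomial (Fin n) k} (hG : G ∈ perpSub k n (typeIdeal d t) d)
    (hconst : ∀ e e' : Fin n →₀ ℕ, e.degree = d → e'.degree = d → coeff e G = coeff e' G) :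
    G = 0 := by
  obtain ⟨f, hf, rfl⟩ := (map_typeSum (k := k) hn).ge (Submodule.mem_top (x := t))
  rw [sum_typeSum hf] at ht
  have hfI := (mem_typeIdeal_iff_of_homogeneous hf).2 (Submodule.mem_span_singleton_self _)
  ext e
  by_cases he : e.degree = d
  · have h := eq_on_homogeneous (A := contractCoeff 0 G)
      (B := coeff e G • (aeval (fun _ => (1 : k)) : _ →ₐ[k] k).toLinearMap) (fun c hc => by
        rw [contractCoeff_monomial, add_zero, hconst c e hc he]
        simp [aeval_monomial, Finsupp.prod]) hf
    rw [← coeff_contract, hG.2 f hfI, coeff_zero] at h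
    change 0 = coeff e G * aeval (fun _ => (1 : k)) f at h
    rw [aeval_eq_eval] at h
    rw [coeff_zero]
    exact (mul_eq_zero.1 h.symm).resolve_right ht
  · rw [IsHomogeneous.coeff_eq_zero hG.1 he, coeff_zero]

theorem exists_smul_sum_X_of_mem_Lset {d : ℕ} (hd : d ≠ 0) (hn : d ≤ n)
    {t : Nat.Partition d → k} (ht : ∑ l, t l ≠ 0) {a : ℕ} {F : Fin a → MvPolynomial (Fin n) k}
    (hF : LinearIndependent k F) (hFmem : ∀ i, F i ∈ perpSub k n (typeIdeal d t) d)
    {l : Fin a → MvPolynomial (Fin n) k} (hl : l ∈ Lset k n F) :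
    ∃ c : Fin a → k, l = fun i => c i • ∑ j, X j := by
  obtain ⟨m, rfl⟩ := Nat.exists_eq_succ_of_ne_zero hd
  obtain ⟨hl1, hl2⟩ := hl
  let G : Fin n → MvPolynomial (Fin n) k :=
    fun j => ∑ i, coeff (Finsupp.single j 1) (l i) • F i
  have hG (j) : G j ∈ perpSub k n (typeIdeal (m + 1) t) (m + 1) :=
    Submodule.sum_mem _ fun i _ => Submodule.smul_mem _ _ (hFmem i)
  have hsum (e : Fin n →₀ ℕ) (_ : e.degree = m) :
      ∑ j, coeff (e + Finsupp.single j 1) (G j) = 0 := by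
    have h := congrArg (coeff e) hl2
    rw [coeff_sum, coeff_zero] at h
    rw [← h]
    simp only [G, coeff_sum, coeff_smul]
    rw [Finset.sum_comm]
    refine Finset.sum_congr rfl fun i _ => ?_
    rw [coeff_contract]
    conv_rhs => rw [eq_sum_smul_X (hl1 i), map_sum]
    refine Finset.sum_congr rfl fun j _ => ?_
    rw [map_smul, X, contractCoeff_monomial, add_comm]
  have heq (a b : Fin n) : G a = G b := by
    rw [← sub_eq_zero]
    refine eq_zero_of_mem_perpSub hn ht (Submodule.sub_mem _ (hG a) (hG b)) fun e e' he he' => ?_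
    rw [coeff_sub, coeff_sub]
    exact sub_eq_sub_of_sum_add_single_eq_zero (g := fun j e => coeff e (G j))
      (fun j e σ he => mapDomain_coeff_of_mem_perpSub (hG j) he σ) hsum a b he he'
  let z : Fin n := ⟨0, by omega⟩
  refine ⟨fun i => coeff (Finsupp.single z 1) (l i), funext fun i => ?_⟩
  conv_lhs => rw [eq_sum_smul_X (hl1 i)]
  rw [Finset.smul_sum]
  refine Finset.sum_congr rfl fun j _ => ?_
  congr 1
  have h0 := sub_eq_zero.2 (heq j z)
  simp only [G, ← Finset.sum_sub_distrib, ← sub_smul] at h0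
  exact sub_eq_zero.1 (Fintype.linearIndependent_iff.1 hF _ h0 i)

theorem isExtremelyNarrow_typeIdeal {d : ℕ} (hd : d ≠ 0) (hn : d ≤ n)
    {t : Nat.Partition d → k} (ht : ∑ l, t l ≠ 0) (hA : hfA k n (typeIdeal d t) d ≠ 0) :
    IsExtremelyNarrow k n d (typeIdeal d t) := by
  have ht0 : t ≠ 0 := by rintro rfl; simp at ht
  refine ⟨isHomog_typeIdeal d t, isArtinianRing_quotient_typeIdeal d t, sdeg_typeIdeal hA,
    tdeg_typeIdeal hn ht0, ?_⟩
  have hle : perpSub k n (typeIdeal d t) d ≤ homogeneousSubmodule (Fin n) k d := fun _ h => h.1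
  have := Submodule.finiteDimensional_of_le hle
  let b := Module.finBasis k (perpSub k n (typeIdeal d t) d)
  have hb : LinearIndependent k fun i => (b i : MvPolynomial (Fin n) k) :=
    b.linearIndependent.map' (Submodule.subtype _) (Submodule.ker_subtype _)
  refine ⟨_, fun i => b i, ⟨hb, fun i => (b i).2, fun g hg => ?_⟩, ∑ j, X j,
    Submodule.sum_mem _ fun j _ => isHomogeneous_X k j,
    fun l hl => exists_smul_sum_X_of_mem_Lset hd hn ht hb (fun i => (b i).2) hl⟩
  have h := congrArg (Submodule.subtype _) (b.sum_repr ⟨g, hg⟩)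
  rw [map_sum] at h
  rw [← show _ = g from h]
  exact Submodule.sum_mem _ fun i _ => by
    rw [map_smul]
    exact Submodule.smul_mem _ _ (Submodule.subset_span ⟨i, rfl⟩)

end Relations

end PSI

namespace PSI

section Socle

variable {k : Type} [Field k] {n : ℕ}

theorem finrank_homogeneousSubmodule (m : ℕ) :
    Module.finrank k (homogeneousSubmodule (Fin n) k m) = (n + m - 1).choose m := by
  let e : Sym (Fin n) m ≃ {e : Fin n →₀ ℕ | e.degree = m} := Sym.equivNatSum (Fin n) m
  have : Fintype {e : Fin n →₀ ℕ | e.degree = m} := Fintype.ofEquiv _ e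
  have hli : LinearIndependent k fun e : {e : Fin n →₀ ℕ | e.degree = m} =>
      monomial (e : Fin n →₀ ℕ) (1 : k) := by
    have := (basisMonomials (Fin n) k).linearIndependent.comp _
      (Subtype.val_injective (p := fun e => e ∈ {e : Fin n →₀ ℕ | e.degree = m}))
    rwa [coe_basisMonomials] at this
  rw [homogeneousSubmodule_eq_span, Set.image_eq_range, finrank_span_eq_card hli,
    ← Fintype.card_congr e, Sym.card_sym_eq_choose, Fintype.card_fin]

theorem finrank_map_add_finrank_inf_ker {V W : Type*} [AddCommGroup V] [Module k V]
    [AddCommGroup W] [Module k W] (U : Submodule k V) [Module.Finite k U] (f : V →ₗ[k] W) :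
    Module.finrank k (U.map f) + Module.finrank k ↥(U ⊓ LinearMap.ker f) =
      Module.finrank k U := by
  rw [← (f.domRestrict U).finrank_range_add_finrank_ker, LinearMap.range_domRestrict,
    ← Submodule.map_comap_subtype, Submodule.finrank_map_subtype_eq]
  rfl

variable (k n) in
/-- The map induced on types by multiplication with the sum of the variables. -/
def raise (m : ℕ) : MvPolynomial (Fin n) k →ₗ[k] (Nat.Partition (m + 1) → k) :=
  ∑ j, typeSum k n (m + 1) ∘ₗ LinearMap.mulLeft k (X j)

theorem raise_apply (m : ℕ) (p : MvPolynomial (Fin n) k) :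
    raise k n m p = ∑ j, typeSum k n (m + 1) (X j * p) := by
  simp [raise]

theorem raise_monomial_mapDomain {m : ℕ} {e : Fin n →₀ ℕ} (he : e.degree = m)
    (σ : Equiv.Perm (Fin n)) :
    raise k n m (monomial (e.mapDomain σ) 1) = raise k n m (monomial e 1) := by
  rw [raise_apply, raise_apply, ← Equiv.sum_comp σ]
  refine Finset.sum_congr rfl fun j _ => ?_
  rw [X_mul_monomial, X_mul_monomial, typeSum_monomial, typeSum_monomial,
    ← Finsupp.mapDomain_single, ← Finsupp.mapDomain_add, ptype_mapDomain]
  all_goals simp [he]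

theorem raise_eq_sum {m : ℕ} {E : Nat.Partition m → Fin n →₀ ℕ} (hE : ∀ l, (E l).degree = m)
    (hE' : ∀ l, ptype m (E l) = l) {p : MvPolynomial (Fin n) k}
    (hp : p ∈ homogeneousSubmodule (Fin n) k m) :
    raise k n m p = ∑ l, typeSum k n m p l • raise k n m (monomial (E l) 1) := by
  classical
  have := eq_on_homogeneous (A := raise k n m)
    (B := ∑ l, (LinearMap.proj l ∘ₗ typeSum k n m).smulRight (raise k n m (monomial (E l) 1)))
    (fun e he => ?_) hp
  · simpa using this
  · rw [LinearMap.sum_apply, Finset.sum_eq_single (ptype m e)]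
    · obtain ⟨σ, hσ⟩ := exists_perm_of_ptype_eq he (hE (ptype m e)) (hE' _).symm
      rw [hσ, LinearMap.smulRight_apply, raise_monomial_mapDomain he, LinearMap.comp_apply,
        typeSum_monomial he]
      simp
    · intro l _ hl
      rw [LinearMap.smulRight_apply, LinearMap.comp_apply, typeSum_monomial he]
      simp [hl]
    · exact fun h => absurd (Finset.mem_univ _) h

theorem ptype_add_single_of_eq_zero {m : ℕ} {e : Fin n →₀ ℕ} (he : e.degree = m) {j : Fin n}
    (hj : e j = 0) : (ptype (m + 1) (e + Finsupp.single j 1)).parts = 1 ::ₘ (ptype m e).parts := by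
  rw [ptype_parts (by simp [he]), ptype_parts he, typeOf_add_single hj one_ne_zero]

theorem card_ptype_add_single_of_ne_zero {m : ℕ} {e : Fin n →₀ ℕ} (he : e.degree = m) {j : Fin n}
    (hj : e j ≠ 0) : (ptype (m + 1) (e + Finsupp.single j 1)).parts.card =
      (ptype m e).parts.card := by
  rw [ptype_parts (by simp [he]), ptype_parts he, typeOf, typeOf, Multiset.card_map,
    Multiset.card_map]
  change (e + Finsupp.single j 1).support.card = e.support.card
  congr 1
  ext i
  rcases eq_or_ne j i with rfl | hij <;> simp_all

theorem typeSum_eq_zero_of_raise_eq_zero [CharZero k] {m : ℕ} (hn : m < n)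
    {p : MvPolynomial (Fin n) k} (hp : p ∈ homogeneousSubmodule (Fin n) k m)
    (h : raise k n m p = 0) : typeSum k n m p = 0 := by
  classical
  by_contra hne
  choose E _ hE hE' using fun l : Nat.Partition m =>
    exists_ptype_eq l (Finset.univ : Finset (Fin n)) (by simpa using hn.le)
  obtain ⟨l₁, hl₁⟩ := Function.ne_iff.1 hne
  obtain ⟨l₀, hl₀, hmax⟩ := Finset.exists_max_image
    (Finset.univ.filter fun l => typeSum k n m p l ≠ 0) (fun l => l.parts.card)
    ⟨l₁, by simpa using hl₁⟩
  have hl₀ : typeSum k n m p l₀ ≠ 0 := by simpa using hl₀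
  obtain ⟨z, hz⟩ : ∃ z, E l₀ z = 0 := by
    by_contra! hz
    have h1 : (E l₀).support = Finset.univ :=
      Finset.eq_univ_of_forall fun i => Finsupp.mem_support_iff.2 (hz i)
    have h2 := card_support_le_degree (E l₀)
    rw [h1, Finset.card_univ, Fintype.card_fin, hE] at h2
    omega
  let q := ptype (m + 1) (E l₀ + Finsupp.single z 1)
  have hq : q.parts = 1 ::ₘ l₀.parts := by
    rw [ptype_add_single_of_eq_zero (hE l₀) hz, hE']
  have hraise (l) : raise k n m (monomial (E l) 1) q =
      (Finset.univ.filter fun j => ptype (m + 1) (E l + Finsupp.single j 1) = q).card := by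
    rw [raise_apply, Finset.sum_apply, Finset.card_filter, Nat.cast_sum]
    refine Finset.sum_congr rfl fun j _ => ?_
    rw [X_mul_monomial, typeSum_monomial (by simp [hE]), Pi.single_apply]
    simp [eq_comm]
  have hzero := congrFun (raise_eq_sum hE hE' hp) q
  rw [h, Finset.sum_apply, Finset.sum_eq_single l₀, Pi.smul_apply, hraise] at hzero
  · have hcard := (smul_eq_zero.1 hzero.symm).resolve_left hl₀
    rw [Nat.cast_eq_zero, Finset.card_eq_zero] at hcard
    have hmem : z ∈ Finset.univ.filter fun j => ptype (m + 1) (E l₀ + Finsupp.single j 1) = q := by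
      simp [q]
    simp [hcard] at hmem
  · intro l _ hl
    rw [Pi.smul_apply]
    by_cases hs : typeSum k n m p l = 0
    · rw [hs, zero_smul]
    · have hle := hmax l (by simpa using hs)
      rw [hraise, Finset.filter_false_of_mem, Finset.card_empty, Nat.cast_zero, smul_zero]
      intro j _ hj
      have hj' := congrArg Nat.Partition.parts hj
      rw [hq] at hj'
      by_cases hlj : E l j = 0
      · rw [ptype_add_single_of_eq_zero (hE l) hlj, hE', Multiset.cons_inj_right] at hj'
        exact hl (Nat.Partition.ext hj')
      · have := congrArg Multiset.card hj'
        rw [card_ptype_add_single_of_ne_zero (hE l) hlj, hE', Multiset.card_cons] at this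
        omega
  · exact fun h => absurd (Finset.mem_univ _) h

theorem finrank_map_raise [CharZero k] {m : ℕ} (hn : m < n) :
    Module.finrank k ((homogeneousSubmodule (Fin n) k m).map (raise k n m)) = Pnum m := by
  have h := finrank_map_eq_of_mem_iff (homogeneousSubmodule (Fin n) k m) (f := raise k n m)
    (g := typeSum k n m) fun p hp => ⟨typeSum_eq_zero_of_raise_eq_zero hn hp, fun h0 => by
      choose E _ hE hE' using fun l : Nat.Partition m =>
        exists_ptype_eq l (Finset.univ : Finset (Fin n)) (by simpa using hn.le)
      rw [raise_eq_sum hE hE' hp, h0]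
      simp⟩
  rw [h, map_typeSum hn.le, finrank_top, Module.finrank_fintype_fun_eq_card, Pnum]

/-- The classes of the products of a polynomial with the variables, modulo `t`. -/
def mulXMod {m : ℕ} (t : Nat.Partition (m + 1) → k) : MvPolynomial (Fin n) k →ₗ[k]
    (Fin n → (Nat.Partition (m + 1) → k) ⧸ Submodule.span k {t}) :=
  LinearMap.pi fun j => (Submodule.span k {t}).mkQ ∘ₗ typeSum k n (m + 1) ∘ₗ
    LinearMap.mulLeft k (X j)

theorem mulXMod_eq_zero_iff {m : ℕ} {t : Nat.Partition (m + 1) → k} {p : MvPolynomial (Fin n) k}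
    (hp : p ∈ homogeneousSubmodule (Fin n) k m) :
    mulXMod t p = 0 ↔ ∀ j, X j * p ∈ typeIdeal (m + 1) t := by
  rw [funext_iff]
  refine forall_congr' fun j => ?_
  rw [mem_typeIdeal_iff_of_homogeneous (X_mul_mem_homogeneousSubmodule hp j)]
  exact Submodule.Quotient.mk_eq_zero _

theorem socdim_eq_finrank {m : ℕ} (t : Nat.Partition (m + 1) → k) :
    socdim k n (typeIdeal (m + 1) t) m = Module.finrank k
      ↥(homogeneousSubmodule (Fin n) k m ⊓ LinearMap.ker (mulXMod (n := n) t)) := by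
  have hle : homogeneousSubmodule (Fin n) k m ⊓ LinearMap.ker (mulXMod (n := n) t) ≤
      homogeneousSubmodule (Fin n) k m := inf_le_left
  have := Submodule.finiteDimensional_of_le hle
  have h := finrank_map_eq_of_mem_iff
    (homogeneousSubmodule (Fin n) k m ⊓ LinearMap.ker (mulXMod (n := n) t))
    (f := (Ideal.Quotient.mkₐ k (typeIdeal (m + 1) t)).toLinearMap) (g := LinearMap.id)
    fun p hp => ⟨fun h => eq_zero_of_mem_typeIdeal m.lt_succ_self hp.1
      (Ideal.Quotient.eq_zero_iff_mem.1 h),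
      fun h => by rw [LinearMap.id_apply] at h; rw [h, map_zero]⟩
  have hU : Agr k n (typeIdeal (m + 1) t) m ⊓ socSub k n (typeIdeal (m + 1) t) =
      (homogeneousSubmodule (Fin n) k m ⊓ LinearMap.ker (mulXMod (n := n) t)).map
        (Ideal.Quotient.mkₐ k (typeIdeal (m + 1) t)).toLinearMap := by
    apply le_antisymm
    · rintro _ ⟨⟨p, hp, rfl⟩, hs⟩
      exact ⟨p, ⟨hp, (mulXMod_eq_zero_iff hp).2 (mk_mem_socSub.1 hs)⟩, rfl⟩
    · rintro _ ⟨p, ⟨hp, hp'⟩, rfl⟩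
      exact ⟨⟨p, hp, rfl⟩, mk_mem_socSub.2 ((mulXMod_eq_zero_iff hp).1 hp')⟩
  rw [Submodule.map_id] at h
  rw [socdim, hU]
  exact h

theorem single_sub_single_mem_map_mulXMod {m : ℕ} (hn : m < n) {t : Nat.Partition (m + 1) → k}
    (ht : ∑ l, t l ≠ 0) (a b : Fin n) (w : (Nat.Partition (m + 1) → k) ⧸ Submodule.span k {t}) :
    Pi.single a w - Pi.single b w ∈ (homogeneousSubmodule (Fin n) k m).map (mulXMod t) := by
  set T := (homogeneousSubmodule (Fin n) k m).map (mulXMod (n := n) t)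
  let g (j : Fin n) : (Nat.Partition (m + 1) → k) →ₗ[k] _ :=
    T.mkQ ∘ₗ LinearMap.single k _ j ∘ₗ (Submodule.span k {t}).mkQ
  have hconst (a b : Fin n) {e e' : Fin n →₀ ℕ} (he : e.degree = m + 1) (he' : e'.degree = m + 1) :
      (g a - g b) (typeSum k n (m + 1) (monomial e 1)) =
        (g a - g b) (typeSum k n (m + 1) (monomial e' 1)) := by
    refine sub_eq_sub_of_sum_add_single_eq_zero
      (g := fun j e => g j (typeSum k n (m + 1) (monomial e 1))) (fun j e σ he => ?_)
      (fun e he => ?_) a b he he'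
    · rw [typeSum_monomial he, typeSum_monomial (by simp [he]), ptype_mapDomain]
    · have hmem : mulXMod t (monomial e 1) ∈ T := ⟨_, isHomogeneous_monomial _ he, rfl⟩
      rw [← (Submodule.Quotient.mk_eq_zero T).2 hmem,
        ← LinearMap.sum_single_apply _ (mulXMod t (monomial e 1)), ← Submodule.mkQ_apply, map_sum]
      refine Finset.sum_congr rfl fun j _ => ?_
      rw [← X_mul_monomial]
      rfl
  let z : Fin n := ⟨0, by omega⟩
  let C := (g a - g b) (typeSum k n (m + 1) (monomial (Finsupp.single z (m + 1)) 1))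
  have hL {p : MvPolynomial (Fin n) k} (hp : p ∈ homogeneousSubmodule (Fin n) k (m + 1)) :
      (g a - g b) (typeSum k n (m + 1) p) = eval (fun _ => 1) p • C := by
    have := eq_on_homogeneous (A := (g a - g b) ∘ₗ typeSum k n (m + 1))
      (B := LinearMap.toSpanSingleton k _ C ∘ₗ
        (aeval (fun _ => (1 : k)) : _ →ₐ[k] k).toLinearMap) (fun e he => ?_) hp
    · change _ = aeval (fun _ => (1 : k)) p • C at this
      rwa [aeval_eq_eval] at this
    · change _ = aeval (fun _ => (1 : k)) (monomial e (1 : k)) • C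
      have h1 : aeval (fun _ => (1 : k)) (monomial e (1 : k)) = 1 := by
        simp [aeval_monomial, Finsupp.prod]
      rw [h1, one_smul]
      exact hconst a b he (by simp)
  have hg (v) (hv : v ∈ Submodule.span k {t}) (j : Fin n) : g j v = 0 := by
    have : (Submodule.span k {t}).mkQ v = 0 := (Submodule.Quotient.mk_eq_zero _).2 hv
    rw [LinearMap.comp_apply, LinearMap.comp_apply, this, map_zero, map_zero]
  have hC : C = 0 := by
    obtain ⟨f, hf, hft⟩ := (map_typeSum (k := k) (n := n) hn).ge (Submodule.mem_top (x := t))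
    have h0 := hL hf
    have htt := Submodule.mem_span_singleton_self (R := k) t
    rw [← sum_typeSum hf, hft, LinearMap.sub_apply, hg t htt, hg t htt, sub_zero] at h0
    exact (smul_eq_zero.1 h0.symm).resolve_left ht
  obtain ⟨v, rfl⟩ := Submodule.mkQ_surjective _ w
  obtain ⟨p, hp, rfl⟩ := (map_typeSum (k := k) (n := n) hn).ge (Submodule.mem_top (x := v))
  have h0 := hL hp
  rw [hC, smul_zero, LinearMap.sub_apply, sub_eq_zero] at h0
  exact (Submodule.Quotient.eq T).1 h0

theorem finrank_map_mulXMod [CharZero k] {m : ℕ} (hn : m < n) {t : Nat.Partition (m + 1) → k}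
    (ht : ∑ l, t l ≠ 0) (htr : t ∉ (homogeneousSubmodule (Fin n) k m).map (raise k n m)) :
    Module.finrank k ((homogeneousSubmodule (Fin n) k m).map (mulXMod (n := n) t)) +
      Pnum (m + 1) + n = n * Pnum (m + 1) + Pnum m + 1 := by
  have ht0 : t ≠ 0 := by rintro rfl; simp at ht
  let Q := (Nat.Partition (m + 1) → k) ⧸ Submodule.span k {t}
  let S : (Fin n → Q) →ₗ[k] Q := ∑ j, LinearMap.proj j
  have hS (v : Fin n → Q) : S v = ∑ j, v j := by simp [S]
  let T := (homogeneousSubmodule (Fin n) k m).map (mulXMod (n := n) t)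
  let z : Fin n := ⟨0, by omega⟩
  have hQ : Module.finrank k Q + 1 = Pnum (m + 1) := by
    have := Submodule.finrank_quotient_add_finrank (Submodule.span k {t})
    rwa [finrank_span_singleton ht0, Module.finrank_fintype_fun_eq_card] at this
  have hker : Module.finrank k Q + Module.finrank k (LinearMap.ker S) =
      n * Module.finrank k Q := by
    have hsurj : Function.Surjective S := fun w => ⟨Pi.single z w, by
      rw [hS, Finset.sum_pi_single']; simp⟩
    have := S.finrank_range_add_finrank_ker
    rw [LinearMap.range_eq_top.2 hsurj, finrank_top, Module.finrank_pi_fintype] at this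
    simpa using this
  have hle : LinearMap.ker S ≤ T := by
    intro v hv
    have hv' : ∑ j, v j = 0 := by rw [← hS]; exact hv
    have : v = ∑ j, (Pi.single j (v j) - Pi.single z (v j)) := by
      have h0 : ∑ j, (Pi.single z (v j) : Fin n → Q) = 0 := by
        have := map_sum (LinearMap.single k (fun _ : Fin n => Q) z) v Finset.univ
        rw [hv', map_zero] at this
        exact this.symm
      rw [Finset.sum_sub_distrib, h0, sub_zero, LinearMap.sum_single_apply]
    rw [this]
    exact Submodule.sum_mem _ fun j _ => single_sub_single_mem_map_mulXMod hn ht j z (v j)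
  have hmap : Module.finrank k (T.map S) = Pnum m := by
    have hcomp : S ∘ₗ mulXMod (n := n) t = (Submodule.span k {t}).mkQ ∘ₗ raise k n m := by
      refine LinearMap.ext fun p => ?_
      rw [LinearMap.comp_apply, LinearMap.comp_apply, hS, raise_apply, map_sum]
      rfl
    rw [← Submodule.map_comp, hcomp, Submodule.map_comp, ← finrank_map_raise (k := k) hn]
    have := finrank_map_eq_of_mem_iff ((homogeneousSubmodule (Fin n) k m).map (raise k n m))
      (f := (Submodule.span k {t}).mkQ) (g := LinearMap.id) fun y hy => ⟨fun h => ?_, fun h => ?_⟩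
    · rwa [Submodule.map_id] at this
    · obtain ⟨c, hc⟩ := Submodule.mem_span_singleton.1 ((Submodule.Quotient.mk_eq_zero _).1 h)
      rcases eq_or_ne c 0 with rfl | hc0
      · rw [← hc, zero_smul, map_zero]
      · refine absurd ?_ htr
        rw [← inv_smul_smul₀ hc0 t, hc]
        exact Submodule.smul_mem _ _ hy
    · rw [LinearMap.id_apply] at h
      rw [h, map_zero]
  have := finrank_map_add_finrank_inf_ker T S
  rw [inf_eq_right.2 hle, hmap] at this
  change Module.finrank k T + _ + _ = _
  rw [← hQ, mul_add, ← hker, ← this]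
  ring

theorem socdim_typeIdeal_pred [CharZero k] {m : ℕ} (hn : m < n) {t : Nat.Partition (m + 1) → k}
    (ht : ∑ l, t l ≠ 0) (htr : t ∉ (homogeneousSubmodule (Fin n) k m).map (raise k n m)) :
    socdim k n (typeIdeal (m + 1) t) m + n * Pnum (m + 1) + Pnum m + 1 =
      (n + m - 1).choose m + Pnum (m + 1) + n := by
  have h1 := finrank_map_add_finrank_inf_ker (homogeneousSubmodule (Fin n) k m) (mulXMod (n := n) t)
  rw [finrank_homogeneousSubmodule, ← socdim_eq_finrank] at h1
  have h2 := finrank_map_mulXMod hn ht htr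
  omega

end Socle

end PSI

namespace PSI

section Final

variable {k : Type} [Field k] {n : ℕ}

theorem Pnum_lt_Pnum_add_one {m : ℕ} (hm : m ≠ 0) : Pnum m < Pnum (m + 1) := by
  let f (p : Nat.Partition m) : Nat.Partition (m + 1) :=
    ⟨1 ::ₘ p.parts, fun {i} hi => by
      rcases Multiset.mem_cons.1 hi with rfl | hi
      · exact one_pos
      · exact p.parts_pos hi, by rw [Multiset.sum_cons, p.parts_sum, add_comm]⟩
  refine Fintype.card_lt_of_injective_of_notMem f (b := Nat.Partition.indiscrete (m + 1))
    (fun p q h => ?_) ?_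
  · exact Nat.Partition.ext ((Multiset.cons_inj_right 1).1 (congrArg Nat.Partition.parts h))
  · rintro ⟨p, hp⟩
    have h1 : (1 : ℕ) ∈ (Nat.Partition.indiscrete (m + 1)).parts := by
      rw [← hp]
      exact Multiset.mem_cons_self _ _
    rw [Nat.Partition.indiscrete_parts (by omega), Multiset.mem_singleton] at h1
    omega

theorem linPoly_ne_zero {d : ℕ} {L : MvPolynomial (Fin n) k →ₗ[k] k} {f : MvPolynomial (Fin n) k}
    (hf : f ∈ homogeneousSubmodule (Fin n) k d) (hL : L f ≠ 0) : linPoly d L ≠ 0 := by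
  intro h
  rw [← eval_linPoly L hf, h, map_zero] at hL
  exact hL rfl

theorem generalPSI_typeIdeal [CharZero k] {m : ℕ} (hm : m ≠ 0)
    (hn : Fintype.card (Nat.Partition (m + 1)) * (m + 1) + (m + 1) < n) :
    GeneralPSI k n (m + 1) fun I => ∃ t : Nat.Partition (m + 1) → k, I = typeIdeal (m + 1) t ∧
      ∑ l, t l ≠ 0 ∧ t ∉ (homogeneousSubmodule (Fin n) k m).map (raise k n m) := by
  have hmn : m < n := by omega
  obtain ⟨f₀, hf₀, h1, hspan⟩ := exists_diffSpan_le_orbitSpan (k := k) hn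
  obtain ⟨h, hh, hspan⟩ := exists_polynomial_diffSpan_le_orbitSpan hf₀ h1 hspan
  have hlt : (homogeneousSubmodule (Fin n) k m).map (raise k n m) < ⊤ := by
    rw [lt_top_iff_ne_top]
    intro htop
    have := finrank_map_raise (k := k) hmn
    rw [htop, finrank_top, Module.finrank_fintype_fun_eq_card] at this
    exact (Pnum_lt_Pnum_add_one hm).ne' this
  obtain ⟨κ, hκ, hker⟩ := Submodule.exists_le_ker_of_lt_top _ hlt
  obtain ⟨L₁, hL₁⟩ : ∃ L : MvPolynomial (Fin n) k →ₗ[k] k, ∀ f, L f = eval (fun _ => 1) f :=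
    ⟨(aeval (fun _ => (1 : k)) : _ →ₐ[k] k).toLinearMap, fun f => by
      change aeval (fun _ => (1 : k)) f = _
      rw [aeval_eq_eval]⟩
  let L₂ : MvPolynomial (Fin n) k →ₗ[k] k := κ ∘ₗ typeSum k n (m + 1)
  have h₁ : linPoly (m + 1) L₁ ≠ 0 := linPoly_ne_zero hf₀ (by rwa [hL₁])
  have h₂ : linPoly (m + 1) L₂ ≠ 0 := by
    obtain ⟨v, hv⟩ : ∃ v, κ v ≠ 0 := by
      by_contra! hv
      exact hκ (LinearMap.ext hv)
    obtain ⟨p, hp, rfl⟩ := (map_typeSum (k := k) (n := n) hmn).ge (Submodule.mem_top (x := v))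
    exact linPoly_ne_zero hp hv
  refine ⟨h * linPoly (m + 1) L₁ * linPoly (m + 1) L₂, mul_ne_zero (mul_ne_zero hh h₁) h₂,
    fun f hf hne => ?_⟩
  replace hne : eval (fun x : DegMon n (m + 1) => coeff x.exponent f)
      (h * linPoly (m + 1) L₁ * linPoly (m + 1) L₂) ≠ 0 := hne
  rw [map_mul, map_mul, eval_linPoly _ hf, eval_linPoly _ hf, hL₁] at hne
  have hne₂ := right_ne_zero_of_mul hne
  have hne₁ := right_ne_zero_of_mul (left_ne_zero_of_mul hne)
  have hne₀ := left_ne_zero_of_mul (left_ne_zero_of_mul hne)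
  refine ⟨_, psi_eq_typeIdeal (by omega) (by omega) hf hne₁ (hspan f hf hne₀), ?_,
    fun hmem => hne₂ (hker hmem)⟩
  rwa [sum_typeSum hf]

end Final

end PSI

/-- Theorem `thm:mainnarrow` (with Lemma `l:narrow`(2)): over an infinite field of
characteristic zero, for `d ≥ 2` and `n` sufficiently large, a general principal
symmetric ideal `I` generated in degree `d` yields `A = R/I` with Hilbert function
`dim_k R_i` for `i ≤ d−1`, `P(d)−1` at `i = d`, `0` above, and `A` is a `d`-extremely
narrow algebra with socle polynomial
`(C(n+d−2,d−1) − (n−1)P(d) − P(d−1) + n − 1)·z^{d−1} + (P(d)−1)·z^d`. -/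
theorem stmt17 (k : Type) [Field k] [Infinite k] [CharZero k] (d : ℕ) (hd : 2 ≤ d) :
    ∃ N : ℕ, ∀ n : ℕ, N ≤ n →
      GeneralPSI k n d (fun I =>
        (∀ i, i + 1 ≤ d → hfA k n I i = rdim k n i) ∧
        hfA k n I d + 1 = Pnum d ∧
        (∀ i, d < i → hfA k n I i = 0) ∧
        IsExtremelyNarrow k n d I ∧
        socdim k n I d + 1 = Pnum d ∧
        (socdim k n I (d - 1) : ℤ) =
          (Nat.choose (n + d - 2) (d - 1) : ℤ) - ((n : ℤ) - 1) * (Pnum d : ℤ) -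
            (Pnum (d - 1) : ℤ) + ((n : ℤ) - 1) ∧
        (∀ j, j ≠ d → j ≠ d - 1 → socdim k n I j = 0)) := by
  obtain ⟨m, rfl⟩ := Nat.exists_eq_add_of_le' (Nat.one_le_of_lt hd)
  have hm : m ≠ 0 := by omega
  refine ⟨Pnum (m + 1) * (m + 1) + (m + 1) + 1, fun n hn => ?_⟩
  obtain ⟨h, hh, H⟩ := generalPSI_typeIdeal (k := k) (n := n) hm hn
  refine ⟨h, hh, fun f hf hne => ?_⟩
  obtain ⟨t, hI, ht, htr⟩ := H f hf hne
  rw [hI]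
  have hmn : m + 1 ≤ n := by omega
  have ht0 : t ≠ 0 := by rintro rfl; simp at ht
  have hself := hfA_typeIdeal_self hmn ht0
  have hP := Pnum_lt_Pnum_add_one hm
  refine ⟨fun i hi => hfA_typeIdeal_of_lt t hi, hself, fun i hi => ?_,
    isExtremelyNarrow_typeIdeal (by omega) hmn ht ?_, by rw [socdim_typeIdeal_self, hself], ?_,
    fun j hj hj' => ?_⟩
  · rw [hfA, Agr_typeIdeal_of_lt t hi, finrank_bot]
  · have : 0 < Pnum m := Fintype.card_pos
    omega
  · have hs := socdim_typeIdeal_pred hmn ht htr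
    rw [Nat.add_sub_cancel, show n + (m + 1) - 2 = n + m - 1 by omega]
    zify at hs
    linarith
  · rcases lt_or_gt_of_ne hj with hlt | hgt
    · exact socdim_typeIdeal_of_add_one_lt (by omega) t (by omega)
    · exact socdim_typeIdeal_of_lt t hgt
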